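/- Under the setting of the context (θ-scheme configurations with parameters N_n, M_n → ∞ satisfying the CFL condition θ N_n T [v]_Lip R² < L M_n, initial positions at the ℓ_n-quantile points of ρ̄, 0 < R_i^{(n),m} ≤ R, and discrete densities ρ_n), there exist a subsequence (ρ_{n_k}) and a function ρ which is a weak solution of the Cauchy problem ∂_t ρ + ∂_x(ρ v(ρ)) = 0, ρ(·,0) = ρ̄, on ℝ × [0,T], such that ρ_{n_k} → ρ strongly in L¹(ℝ × [0,T]); here a weak solution is a compactly supported ρ ∈ L∞(ℝ × [0,T]) with 0 ≤ ρ ≤ R a.e. satisfying ∫_0^T ∫_ℝ ( ρ ∂_t φ + ρ v(ρ) ∂_x φ ) dx dt + ∫_ℝ ρ̄(x) φ(x,0) dx = 0 for every continuously differentiable φ with compact support in ℝ × [0,T). -/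

import Mathlib

open MeasureTheory Filter


/-- Discrete density `R_i^m = ℓ/(x_{i+1}^m - x_i^m)` for `i < N`, with the
convention `R_N^m = 0`. -/
noncomputable def Rd (N : ℕ) (l : ℝ) (x : ℕ → ℕ → ℝ) (i m : ℕ) : ℝ :=
  if i < N then l / (x (i + 1) m - x i m) else 0

/-- A particle configuration for the θ-scheme with parameters `N, M, ℓ, τ`. -/
def IsScheme (N M : ℕ) (l τ θ : ℝ) (v : ℝ → ℝ) (x : ℕ → ℕ → ℝ) : Prop :=
  (∀ m ≤ M, ∀ i < N, x i m < x (i + 1) m) ∧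
  (∀ m < M, x N (m + 1) = x N m + τ * v 0) ∧
  (∀ m < M, ∀ i < N,
    x i (m + 1) = x i m + τ * (θ * v (Rd N l x i m) + (1 - θ) * v (Rd N l x i (m + 1))))

/-- The fully discrete density
`ρ_N^M(y,t) = Σ_m Σ_i R_i^m 1_{[x_i^m, x_{i+1}^m)}(y) 1_{[t^m, t^{m+1})}(t)`. -/
noncomputable def discDens (N M : ℕ) (l τ : ℝ) (x : ℕ → ℕ → ℝ) (y t : ℝ) : ℝ :=
  ∑ m ∈ Finset.range M, ∑ i ∈ Finset.range N,
    Rd N l x i m * Set.indicator (Set.Ico (x i m) (x (i + 1) m)) (fun _ => (1 : ℝ)) y *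
      Set.indicator (Set.Ico ((m : ℝ) * τ) (((m : ℝ) + 1) * τ)) (fun _ => (1 : ℝ)) t



lemma cws_between (l τθ Lv R r s e : ℝ) (v : ℝ → ℝ)
    (hl : 0 < l) (hr : 0 < r) (hrR : r ≤ R) (hs : 0 ≤ s) (hsR : s ≤ R)
    (hτ : 0 ≤ τθ) (hcfl : τθ * Lv * R ^ 2 ≤ l)
    (hanti : AntitoneOn v (Set.Icc 0 R))
    (hLv : ∀ a ∈ Set.Icc (0 : ℝ) R, ∀ b ∈ Set.Icc (0 : ℝ) R, |v a - v b| ≤ Lv * |a - b|)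
    (he : e = l / r + τθ * (v s - v r)) :
    0 < e ∧ |l / e - r| + |s - l / e| = |s - r| := by
  have hrm : r ∈ Set.Icc (0:ℝ) R := ⟨hr.le, hrR⟩
  have hsm : s ∈ Set.Icc (0:ℝ) R := ⟨hs, hsR⟩
  have hR : 0 < R := hr.trans_le hrR
  have hL := hLv s hsm r hrm
  -- key inequality
  have key : ∀ a b : ℝ, 0 < a → a ≤ b → b ≤ R → τθ * (Lv * (b - a)) ≤ l / a - l / b := by
    intro a b ha hab hb
    have hb0 : 0 < b := ha.trans_le hab
    have h1 : l / a - l / b = l * (b - a) / (a * b) := by field_simp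
    rw [h1, le_div_iff₀ (by positivity)]
    have h2 : a * b ≤ R ^ 2 := by nlinarith
    by_cases hLn : 0 ≤ Lv
    · have : τθ * Lv * (a * b) ≤ l := le_trans (by gcongr) hcfl
      nlinarith [sub_nonneg.2 hab]
    · have hn : τθ * Lv * (a*b) ≤ 0 := by
        have : τθ * Lv ≤ 0 := by nlinarith
        have h3 : 0 < a * b := by positivity
        nlinarith
      nlinarith [sub_nonneg.2 hab]
  rcases le_total s r with h | h
  · have hv := hanti hsm hrm h
    have hlr : 0 < l / r := by positivity
    have hele : l / r ≤ e := by rw [he]; nlinarith [mul_nonneg hτ (sub_nonneg.2 hv)]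
    have he0 : 0 < e := hlr.trans_le hele
    refine ⟨he0, ?_⟩
    have h1 : l / e ≤ r := by
      rw [div_le_iff₀ he0]; rw [div_le_iff₀ hr] at hele; linarith
    have h2 : s ≤ l / e := by
      rcases hs.eq_or_lt with h0 | h0
      · rw [← h0]; positivity
      · have := key s r h0 h hrR
        rw [abs_of_nonneg (sub_nonneg.2 hv), abs_of_nonpos (sub_nonpos.2 h)] at hL
        have h3 : e ≤ l / s := by
          rw [he]
          have := mul_le_mul_of_nonneg_left hL hτ
          have h5 : τθ * (Lv * -(s - r)) = τθ * (Lv * (r - s)) := by ring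
          linarith
        rw [le_div_iff₀ he0]; rw [le_div_iff₀ h0] at h3; linarith
    rw [abs_of_nonpos (by linarith), abs_of_nonpos (by linarith), abs_of_nonpos (by linarith)]
    ring
  · have hs0 : 0 < s := hr.trans_le h
    have hv := hanti hrm hsm h
    have := key r s hr h hsR
    rw [abs_of_nonpos (sub_nonpos.2 hv), abs_of_nonneg (sub_nonneg.2 h)] at hL
    have h3 : l / s ≤ e := by
      rw [he]
      have := mul_le_mul_of_nonneg_left hL hτ
      have h5 : τθ * -(v s - v r) = - (τθ * (v s - v r)) := by ring
      linarith
    have he0 : 0 < e := lt_of_lt_of_le (by positivity) h3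
    have h4 : e ≤ l / r := by rw [he]; nlinarith [mul_nonneg hτ (sub_nonneg.2 hv)]
    refine ⟨he0, ?_⟩
    have h1 : r ≤ l / e := by
      rw [le_div_iff₀ he0]; rw [le_div_iff₀ hr] at h4; linarith
    have h2 : l / e ≤ s := by
      rw [div_le_iff₀ he0]; rw [div_le_iff₀ hs0] at h3; linarith
    rw [abs_of_nonneg (by linarith), abs_of_nonneg (by linarith), abs_of_nonneg (by linarith)]
    ring

lemma cws_between2 (l μ R r s e : ℝ) (v : ℝ → ℝ)
    (hl : 0 < l) (hr : 0 < r) (hrR : r ≤ R) (hs : 0 ≤ s) (hsR : s ≤ R) (he0 : 0 < e)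
    (hμ : 0 ≤ μ) (hanti : AntitoneOn v (Set.Icc 0 R))
    (he : l / r = e + μ * (v s - v r)) :
    |l / e - r| + |r - s| = |l / e - s| := by
  have hrm : r ∈ Set.Icc (0:ℝ) R := ⟨hr.le, hrR⟩
  have hsm : s ∈ Set.Icc (0:ℝ) R := ⟨hs, hsR⟩
  rcases le_total s r with h | h
  · have hv := hanti hsm hrm h
    have h1 : e ≤ l / r := by nlinarith [mul_nonneg hμ (sub_nonneg.2 hv)]
    have h2 : r ≤ l / e := by
      rw [le_div_iff₀ he0]; rw [le_div_iff₀ hr] at h1; linarith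
    rw [abs_of_nonneg (by linarith), abs_of_nonneg (by linarith), abs_of_nonneg (by linarith)]
    ring
  · have hv := hanti hrm hsm h
    have h1 : l / r ≤ e := by nlinarith [mul_nonneg hμ (sub_nonneg.2 hv)]
    have h2 : l / e ≤ r := by
      rw [div_le_iff₀ he0]; rw [div_le_iff₀ hr] at h1; linarith
    rw [abs_of_nonpos (by linarith), abs_of_nonpos (by linarith), abs_of_nonpos (by linarith)]
    ring

/-- One step of the scheme does not increase the total variation. -/
lemma cws_tv_step (N : ℕ) (l τ θ Lv R : ℝ) (v : ℝ → ℝ) (r r' : ℕ → ℝ)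
    (hl : 0 < l) (hτ : 0 ≤ τ) (hθ0 : 0 ≤ θ) (hθ1 : θ ≤ 1)
    (hcfl : τ * θ * Lv * R ^ 2 ≤ l)
    (hanti : AntitoneOn v (Set.Icc 0 R))
    (hLv : ∀ a ∈ Set.Icc (0 : ℝ) R, ∀ b ∈ Set.Icc (0 : ℝ) R, |v a - v b| ≤ Lv * |a - b|)
    (hR : 0 < R) (hr : ∀ i < N, 0 < r i ∧ r i ≤ R) (hr' : ∀ i < N, 0 < r' i ∧ r' i ≤ R)
    (hrN : r N = 0) (hrN' : r' N = 0)
    (hstep : ∀ i < N, l / r' i - l / r i =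
      τ * (θ * (v (r (i+1)) - v (r i)) + (1 - θ) * (v (r' (i+1)) - v (r' i)))) :
    ∑ i ∈ Finset.range N, |r' (i+1) - r' i| ≤ ∑ i ∈ Finset.range N, |r (i+1) - r i| := by
  let b : ℕ → ℝ := fun i => if i < N then l / (l / r i + τ * θ * (v (r (i+1)) - v (r i))) else 0
  let p : ℕ → ℝ := fun i => |b i - r' i| + |b i - r i|
  have hbd : ∀ (q : ℕ → ℝ), (∀ i < N, 0 < q i ∧ q i ≤ R) → q N = 0 → ∀ i < N,
      0 ≤ q (i+1) ∧ q (i+1) ≤ R := by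
    intro q hq hqN i hi
    rcases Nat.lt_or_ge (i+1) N with h | h
    · exact ⟨(hq _ h).1.le, (hq _ h).2⟩
    · have : i + 1 = N := by omega
      rw [this, hqN]; exact ⟨le_rfl, hR.le⟩
  have key : ∀ i ∈ Finset.range N, |r' (i+1) - r' i| ≤ |r (i+1) - r i| + (p (i+1) - p i) := by
    intro i hi
    have hi' : i < N := Finset.mem_range.1 hi
    have h1 := cws_between l (τ * θ) Lv R (r i) (r (i+1)) _ v hl (hr i hi').1 (hr i hi').2
      (hbd r hr hrN i hi').1 (hbd r hr hrN i hi').2 (by positivity) hcfl hanti hLv rfl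
    have h2 := cws_between2 l (τ * (1 - θ)) R (r' i) (r' (i+1))
      (l / r i + τ * θ * (v (r (i+1)) - v (r i))) v hl (hr' i hi').1 (hr' i hi').2
      (hbd r' hr' hrN' i hi').1 (hbd r' hr' hrN' i hi').2 h1.1
      (mul_nonneg hτ (by linarith)) hanti (by have := hstep i hi'; linarith)
    have hb : b i = l / (l / r i + τ * θ * (v (r (i+1)) - v (r i))) := by simp [b, hi']
    rw [← hb] at h1 h2
    have h3 := h1.2
    simp only [p]
    have t1 : |b i - r' (i+1)| ≤ |r (i+1) - b i| + |b (i+1) - r (i+1)| + |b (i+1) - r' (i+1)| := by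
      have e1 : b i - r' (i+1) = -(r (i+1) - b i) + (-(b (i+1) - r (i+1)) + (b (i+1) - r' (i+1))) := by
        ring
      rw [e1]
      refine (abs_add_le _ _).trans ?_
      have := abs_add_le (-(b (i+1) - r (i+1))) (b (i+1) - r' (i+1))
      rw [abs_neg] at this ⊢
      linarith
    have t2 : |r' (i+1) - r' i| = |r' i - r' (i+1)| := abs_sub_comm _ _
    linarith
  refine (Finset.sum_le_sum key).trans ?_
  rw [Finset.sum_add_distrib, Finset.sum_range_sub]
  have hpN : p N = 0 := by simp [p, b, hrN, hrN']
  have hp0 : 0 ≤ p 0 := by positivity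
  linarith

/-- Time variation of the discrete densities in Lagrangian labels. -/
lemma cws_time_var (l τ θ Lv R r s r' s' : ℝ) (v : ℝ → ℝ)
    (hl : 0 < l) (hτ : 0 ≤ τ) (hθ0 : 0 ≤ θ) (hθ1 : θ ≤ 1) (hLv0 : 0 ≤ Lv)
    (hLv : ∀ a ∈ Set.Icc (0 : ℝ) R, ∀ b ∈ Set.Icc (0 : ℝ) R, |v a - v b| ≤ Lv * |a - b|)
    (hr : 0 < r ∧ r ≤ R) (hr' : 0 < r' ∧ r' ≤ R)
    (hs : s ∈ Set.Icc 0 R) (hs' : s' ∈ Set.Icc 0 R)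
    (hstep : l / r' - l / r = τ * (θ * (v s - v r) + (1 - θ) * (v s' - v r'))) :
    l * |r' - r| ≤ R ^ 2 * τ * Lv * (|s - r| + |s' - r'|) := by
  have hrp := hr.1
  have hrp' := hr'.1
  have e1 : l * (r' - r) = -(r * r' * (l / r' - l / r)) := by field_simp; ring
  have e2 : l * |r' - r| = r * r' * |l / r' - l / r| := by
    rw [← abs_of_pos hl, ← abs_mul, abs_of_pos hl, e1, abs_neg, abs_mul, abs_of_pos (by positivity : 0 < r * r')]
  rw [e2, hstep, abs_mul, abs_of_nonneg hτ]
  have h1 := hLv s hs r ⟨hrp.le, hr.2⟩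
  have h2 := hLv s' hs' r' ⟨hrp'.le, hr'.2⟩
  have h3 : |θ * (v s - v r) + (1 - θ) * (v s' - v r')| ≤ Lv * (|s - r| + |s' - r'|) := by
    refine (abs_add_le _ _).trans ?_
    rw [abs_mul, abs_mul, abs_of_nonneg hθ0, abs_of_nonneg (by linarith : 0 ≤ 1 - θ)]
    have := abs_nonneg (v s - v r)
    have := abs_nonneg (v s' - v r')
    nlinarith
  have h4 : r * r' ≤ R ^ 2 := by nlinarith [hr.2, hr'.2]
  calc r * r' * (τ * |θ * (v s - v r) + (1 - θ) * (v s' - v r')|)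
      ≤ R ^ 2 * (τ * (Lv * (|s - r| + |s' - r'|))) := by gcongr
    _ = _ := by ring

/-- Summation by parts. -/
lemma cws_abel (N : ℕ) (r g : ℕ → ℝ) :
    ∑ i ∈ Finset.range N, r i * (g i - g (i+1)) =
      r 0 * g 0 + ∑ i ∈ Finset.range N, (r (i+1) - r i) * g (i+1) - r N * g N := by
  induction N with
  | zero => simp
  | succ n ih => rw [Finset.sum_range_succ, Finset.sum_range_succ, ih]; ring

/-- Asymptotic Arzela-Ascoli. -/
lemma cws_ascoli {K : Type*} [PseudoMetricSpace K] [CompactSpace K] [Nonempty K]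
    (F : ℕ → K → ℝ) (C D : ℝ) (ε : ℕ → ℝ) (hD : 0 ≤ D)
    (hb : ∀ n p, |F n p| ≤ C)
    (he : ∀ n p q, |F n p - F n q| ≤ D * dist p q + ε n)
    (hε : Tendsto ε atTop (nhds 0)) :
    ∃ φ : ℕ → ℕ, StrictMono φ ∧ ∀ δ > 0, ∃ k0, ∀ k ≥ k0, ∀ j ≥ k0, ∀ p,
      |F (φ k) p - F (φ j) p| ≤ δ := by
  let u := TopologicalSpace.denseSeq K
  have hcomp : IsCompact (Set.pi Set.univ (fun _ : ℕ => Set.Icc (-C) C)) :=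
    isCompact_univ_pi (fun _ => isCompact_Icc)
  obtain ⟨a, -, φ, hφ, hlim⟩ := hcomp.tendsto_subseq (x := fun n j => F n (u j))
    (fun n j _ => abs_le.1 (hb n (u j)))
  refine ⟨φ, hφ, fun δ hδ => ?_⟩
  set η := δ / (8 * (D + 1)) with hη
  have hη0 : 0 < η := by positivity
  obtain ⟨t, ht⟩ := isCompact_univ.elim_finite_subcover (fun j : ℕ => Metric.ball (u j) η)
    (fun _ => Metric.isOpen_ball) (by
      intro p _
      obtain ⟨j, hj⟩ := (TopologicalSpace.denseRange_denseSeq K).exists_dist_lt p hη0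
      exact Set.mem_iUnion.2 ⟨j, hj⟩)
  have h1 : ∀ j ∈ t, ∀ᶠ k in atTop, |F (φ k) (u j) - a j| < δ / 8 := by
    intro j _
    have := (tendsto_pi_nhds.1 hlim) j
    exact (Metric.tendsto_nhds.1 this (δ/8) (by positivity))
  have h2 : ∀ᶠ k in atTop, ∀ j ∈ t, |F (φ k) (u j) - a j| < δ / 8 :=
    (Filter.eventually_all_finset t).2 h1
  have h3 : ∀ᶠ k in atTop, |ε (φ k)| < δ / 8 := by
    have := (Metric.tendsto_nhds.1 (hε.comp hφ.tendsto_atTop) (δ/8) (by positivity))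
    simpa using this
  obtain ⟨k0, hk0⟩ := eventually_atTop.1 (h2.and h3)
  refine ⟨k0, fun k hk j hj p => ?_⟩
  obtain ⟨i, hi, hp⟩ : ∃ i ∈ t, p ∈ Metric.ball (u i) η := by
    have := ht (Set.mem_univ p)
    simpa using this
  have hd : D * dist p (u i) ≤ δ / 8 := by
    have : dist p (u i) ≤ η := (Metric.mem_ball.1 hp).le
    calc D * dist p (u i) ≤ (D + 1) * η := by gcongr; linarith
      _ = δ / 8 := by rw [hη]; field_simp
  have a1 := abs_le.1 (he (φ k) p (u i))
  have a2 := abs_le.1 (he (φ j) p (u i))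
  have a3 := abs_lt.1 ((hk0 k hk).1 i hi)
  have a4 := abs_lt.1 ((hk0 j hj).1 i hi)
  have a5 := abs_lt.1 ((hk0 k hk).2)
  have a6 := abs_lt.1 ((hk0 j hj).2)
  rw [abs_le]; constructor <;> linarith


/-- Spatial profile at a fixed time. -/
noncomputable def cwsDens (N : ℕ) (r X : ℕ → ℝ) (y : ℝ) : ℝ :=
  ∑ i ∈ Finset.range N, r i * Set.indicator (Set.Ico (X i) (X (i + 1))) (fun _ => (1 : ℝ)) y

/-- Its primitive. -/
noncomputable def cwsCum (N : ℕ) (r X : ℕ → ℝ) (y : ℝ) : ℝ :=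
  ∑ i ∈ Finset.range N, r i * (max (y - X i) 0 - max (y - X (i + 1)) 0)

/-- Pointwise bound for the difference quotient. -/
noncomputable def cwsB (N : ℕ) (r X : ℕ → ℝ) (h y : ℝ) : ℝ :=
  r 0 * Set.indicator (Set.Ico (X 0 - h) (X 0)) (fun _ => (1 : ℝ)) y +
  ∑ i ∈ Finset.range N, |r (i+1) - r i| *
    Set.indicator (Set.Ico (X (i+1) - h) (X (i + 1))) (fun _ => (1 : ℝ)) y

noncomputable def cwsH (y a : ℝ) : ℝ := if a ≤ y then 1 else 0

lemma cwsH_anti (y : ℝ) {a b : ℝ} (h : a ≤ b) : cwsH y b ≤ cwsH y a := by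
  unfold cwsH; split_ifs <;> linarith

lemma cws_ind (y a b : ℝ) (h : a ≤ b) :
    Set.indicator (Set.Ico a b) (fun _ => (1 : ℝ)) y = cwsH y a - cwsH y b := by
  unfold cwsH
  by_cases h1 : a ≤ y <;> by_cases h2 : b ≤ y <;> simp [Set.indicator, h1, h2]
  linarith

lemma cws_dens_eq (N : ℕ) (r X : ℕ → ℝ) (hX : ∀ i < N, X i < X (i+1)) (y : ℝ) :
    cwsDens N r X y = ∑ i ∈ Finset.range N, r i * (cwsH y (X i) - cwsH y (X (i+1))) := by
  refine Finset.sum_congr rfl fun i hi => ?_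
  rw [cws_ind _ _ _ (hX i (Finset.mem_range.1 hi)).le]

lemma cws_dens_nonneg (N : ℕ) (r X : ℕ → ℝ) (hr : ∀ i < N, 0 ≤ r i) (y : ℝ) :
    0 ≤ cwsDens N r X y := by
  refine Finset.sum_nonneg fun i hi => mul_nonneg (hr i (Finset.mem_range.1 hi)) ?_
  exact Set.indicator_nonneg (fun _ _ => zero_le_one) _

lemma cws_tele (N : ℕ) (r g : ℕ → ℝ) (R : ℝ) (hr : ∀ i < N, r i ≤ R)
    (hg : ∀ i < N, g (i+1) ≤ g i) :
    ∑ i ∈ Finset.range N, r i * (g i - g (i+1)) ≤ R * (g 0 - g N) := by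
  rw [← Finset.sum_range_sub', Finset.mul_sum]
  refine Finset.sum_le_sum fun i hi => ?_
  have hi := Finset.mem_range.1 hi
  exact mul_le_mul_of_nonneg_right (hr i hi) (sub_nonneg.2 (hg i hi))

lemma cws_dens_le (N : ℕ) (r X : ℕ → ℝ) (R : ℝ) (hR : 0 ≤ R) (hX : ∀ i < N, X i < X (i+1))
    (hr : ∀ i < N, r i ≤ R) (y : ℝ) : cwsDens N r X y ≤ R := by
  rw [cws_dens_eq N r X hX]
  refine (cws_tele N r (fun i => cwsH y (X i)) R hr (fun i hi => cwsH_anti y (hX i hi).le)).trans ?_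
  have : cwsH y (X 0) - cwsH y (X N) ≤ 1 := by
    unfold cwsH; split_ifs <;> norm_num
  nlinarith

lemma cws_mono_X (N : ℕ) (X : ℕ → ℝ) (hX : ∀ i < N, X i < X (i+1)) :
    ∀ j ≤ N, ∀ i ≤ j, X i ≤ X j := by
  intro j
  induction j with
  | zero => intro _ i hi; rw [Nat.le_zero.1 hi]
  | succ j ih =>
    intro hj i hi
    rcases Nat.lt_or_ge i (j+1) with h | h
    · exact (ih (by omega) i (by omega)).trans (hX j (by omega)).le
    · rw [le_antisymm hi h]

lemma cws_dens_zero (N : ℕ) (r X : ℕ → ℝ) (hX : ∀ i < N, X i < X (i+1)) (y : ℝ)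
    (hy : y < X 0 ∨ X N ≤ y) : cwsDens N r X y = 0 := by
  refine Finset.sum_eq_zero fun i hi => ?_
  have hi := Finset.mem_range.1 hi
  have h0 := cws_mono_X N X hX i hi.le 0 (Nat.zero_le _)
  have h1 := cws_mono_X N X hX N le_rfl (i+1) hi
  rw [Set.indicator_of_notMem, mul_zero]
  rintro ⟨h2, h3⟩
  rcases hy with h | h <;> linarith

lemma cws_dens_meas (N : ℕ) (r X : ℕ → ℝ) : Measurable (cwsDens N r X) := by
  unfold cwsDens
  refine Finset.measurable_sum _ fun i _ => ?_
  exact (measurable_const.indicator measurableSet_Ico).const_mul _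

lemma cws_ind_int (a b c : ℝ) :
    Integrable (fun y => c * Set.indicator (Set.Ico a b) (fun _ => (1 : ℝ)) y) := by
  refine Integrable.const_mul ?_ _
  exact (integrable_indicator_iff measurableSet_Ico).2 (integrableOn_const (by simp) (by simp))

lemma cws_ind_val (a b c : ℝ) (h : a ≤ b) :
    ∫ y, c * Set.indicator (Set.Ico a b) (fun _ => (1 : ℝ)) y = c * (b - a) := by
  rw [integral_const_mul, integral_indicator measurableSet_Ico]
  simp [h]

lemma cws_dens_int (N : ℕ) (r X : ℕ → ℝ) : Integrable (cwsDens N r X) := by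
  unfold cwsDens
  exact integrable_finsetSum _ fun i _ => cws_ind_int _ _ _

lemma cwsB_int (N : ℕ) (r X : ℕ → ℝ) (h : ℝ) : Integrable (cwsB N r X h) := by
  unfold cwsB
  exact (cws_ind_int _ _ _).add (integrable_finsetSum _ fun i _ => cws_ind_int _ _ _)

lemma cwsB_val (N : ℕ) (r X : ℕ → ℝ) (h : ℝ) (hh : 0 ≤ h) :
    ∫ y, cwsB N r X h y = h * (r 0 + ∑ i ∈ Finset.range N, |r (i+1) - r i|) := by
  unfold cwsB
  rw [integral_add (cws_ind_int _ _ _) (integrable_finsetSum _ fun i _ => cws_ind_int _ _ _),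
    integral_finsetSum _ (fun i _ => cws_ind_int _ _ _), cws_ind_val _ _ _ (by linarith)]
  rw [Finset.sum_congr rfl (fun i _ => cws_ind_val _ _ _ (by linarith))]
  rw [mul_add, Finset.mul_sum]
  congr 1
  · ring
  · refine Finset.sum_congr rfl fun i _ => by ring

lemma cws_quot_one (y a h : ℝ) (hh : 0 < h) :
    |cwsH y a - (max (y + h - a) 0 - max (y - a) 0) / h| ≤
      Set.indicator (Set.Ico (a - h) a) (fun _ => (1 : ℝ)) y := by
  unfold cwsH
  rcases le_or_gt a y with h1 | h1
  · rw [max_eq_left (by linarith), max_eq_left (by linarith), if_pos h1]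
    have : (y + h - a - (y - a)) / h = 1 := by field_simp; ring
    rw [this]; simp
    exact Set.indicator_nonneg (fun _ _ => zero_le_one) _
  · rw [max_eq_right (by linarith : y - a ≤ 0), if_neg (not_le.2 h1)]
    rcases le_or_gt (a - h) y with h2 | h2
    · rw [Set.indicator_of_mem (show y ∈ Set.Ico (a-h) a from ⟨h2, h1⟩), max_eq_left (by linarith)]
      simp only [zero_sub, sub_zero, abs_neg]
      rw [abs_of_nonneg (div_nonneg (by linarith) hh.le), div_le_one hh]; linarith
    · rw [max_eq_right (by linarith)]
      simp
      exact Set.indicator_nonneg (fun _ _ => zero_le_one) _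

lemma cws_quot (N : ℕ) (r X : ℕ → ℝ) (hX : ∀ i < N, X i < X (i+1)) (hr0 : 0 ≤ r 0)
    (hrN : r N = 0) (h y : ℝ) (hh : 0 < h) :
    |cwsDens N r X y - (cwsCum N r X (y + h) - cwsCum N r X y) / h| ≤ cwsB N r X h y := by
  let g : ℕ → ℝ := fun i => cwsH y (X i) - (max (y + h - X i) 0 - max (y - X i) 0) / h
  have e : cwsDens N r X y - (cwsCum N r X (y + h) - cwsCum N r X y) / h =
      ∑ i ∈ Finset.range N, r i * (g i - g (i+1)) := by
    rw [cws_dens_eq N r X hX]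
    unfold cwsCum
    rw [← Finset.sum_sub_distrib, Finset.sum_div, ← Finset.sum_sub_distrib]
    refine Finset.sum_congr rfl fun i _ => ?_
    simp only [g]; ring
  rw [e, cws_abel, hrN, zero_mul, sub_zero]
  unfold cwsB
  refine (abs_add_le _ _).trans (add_le_add ?_ ((Finset.abs_sum_le_sum_abs _ _).trans
    (Finset.sum_le_sum fun i _ => ?_)))
  · rw [abs_mul, abs_of_nonneg hr0]
    exact mul_le_mul_of_nonneg_left (cws_quot_one y (X 0) h hh) hr0
  · rw [abs_mul]
    exact mul_le_mul_of_nonneg_left (cws_quot_one y (X (i+1)) h hh) (abs_nonneg _)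

lemma cws_L1 (N N' : ℕ) (r X r' X' : ℕ → ℝ) (A B C h ε : ℝ)
    (hX : ∀ i < N, X i < X (i+1)) (hr0 : 0 ≤ r 0) (hrN : r N = 0)
    (hX' : ∀ i < N', X' i < X' (i+1)) (hr0' : 0 ≤ r' 0) (hrN' : r' N' = 0)
    (hC : r 0 + ∑ i ∈ Finset.range N, |r (i+1) - r i| ≤ C)
    (hC' : r' 0 + ∑ i ∈ Finset.range N', |r' (i+1) - r' i| ≤ C)
    (hA : A ≤ X 0) (hA' : A ≤ X' 0) (hB : X N ≤ B) (hB' : X' N' ≤ B) (hAB : A ≤ B)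
    (hh : 0 < h) (hh1 : h ≤ 1)
    (hε : ∀ y ∈ Set.Icc A (B + 1), |cwsCum N r X y - cwsCum N' r' X' y| ≤ ε) :
    ∫ y, |cwsDens N r X y - cwsDens N' r' X' y| ≤ 2 * h * C + 2 * ε / h * (B - A) := by
  have hε0 : 0 ≤ ε := (abs_nonneg _).trans (hε A ⟨le_rfl, by linarith⟩)
  have bnn : ∀ y, 0 ≤ cwsB N r X h y := fun y => (abs_nonneg _).trans (cws_quot N r X hX hr0 hrN h y hh)
  have bnn' : ∀ y, 0 ≤ cwsB N' r' X' h y :=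
    fun y => (abs_nonneg _).trans (cws_quot N' r' X' hX' hr0' hrN' h y hh)
  have key : ∀ y, |cwsDens N r X y - cwsDens N' r' X' y| ≤
      cwsB N r X h y + cwsB N' r' X' h y +
        2 * ε / h * Set.indicator (Set.Ico A B) (fun _ => (1 : ℝ)) y := by
    intro y
    by_cases hy : y ∈ Set.Ico A B
    · rw [Set.indicator_of_mem hy]
      have h1 := abs_le.1 (cws_quot N r X hX hr0 hrN h y hh)
      have h2 := abs_le.1 (cws_quot N' r' X' hX' hr0' hrN' h y hh)
      have h3 := abs_le.1 (hε y ⟨hy.1, by linarith [hy.2]⟩)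
      have h4 := abs_le.1 (hε (y+h) ⟨by linarith [hy.1], by linarith [hy.2]⟩)
      have h5 : (cwsCum N r X (y + h) - cwsCum N r X y) / h -
          (cwsCum N' r' X' (y + h) - cwsCum N' r' X' y) / h ≤ 2 * ε / h := by
        rw [← sub_div]; gcongr; linarith
      have h6 : -(2 * ε / h) ≤ (cwsCum N r X (y + h) - cwsCum N r X y) / h -
          (cwsCum N' r' X' (y + h) - cwsCum N' r' X' y) / h := by
        rw [← sub_div, ← neg_div]; gcongr; linarith
      rw [abs_le]; constructor <;> linarith
    · have hy' : y < A ∨ B ≤ y := by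
        by_contra hc; push Not at hc; exact hy ⟨hc.1, hc.2⟩
      rw [cws_dens_zero N r X hX y (by rcases hy' with h | h; left; linarith; right; linarith),
        cws_dens_zero N' r' X' hX' y (by rcases hy' with h | h; left; linarith; right; linarith),
        Set.indicator_of_notMem hy]
      simp only [sub_zero, abs_zero, mul_zero, add_zero]
      linarith [bnn y, bnn' y]
  have i1 := cwsB_int N r X h
  have i2 := cwsB_int N' r' X' h
  have i3 := cws_ind_int A B (2 * ε / h)
  calc ∫ y, |cwsDens N r X y - cwsDens N' r' X' y| ≤ ∫ y, (cwsB N r X h y + cwsB N' r' X' h y +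
        2 * ε / h * Set.indicator (Set.Ico A B) (fun _ => (1 : ℝ)) y) := by
        refine integral_mono ?_ ((i1.add i2).add i3) key
        exact ((cws_dens_int N r X).sub (cws_dens_int N' r' X')).abs
    _ = h * (r 0 + ∑ i ∈ Finset.range N, |r (i+1) - r i|) +
        h * (r' 0 + ∑ i ∈ Finset.range N', |r' (i+1) - r' i|) + 2 * ε / h * (B - A) := by
        have i12 : Integrable (fun y => cwsB N r X h y + cwsB N' r' X' h y) := i1.add i2
        rw [integral_add i12 i3, integral_add i1 i2, cwsB_val _ _ _ _ hh.le,
          cwsB_val _ _ _ _ hh.le, cws_ind_val _ _ _ hAB]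
    _ ≤ _ := by
        have := mul_le_mul_of_nonneg_left hC hh.le
        have := mul_le_mul_of_nonneg_left hC' hh.le
        linarith

lemma cws_cum_shift (N : ℕ) (r X : ℕ → ℝ) (R : ℝ) (hR : 0 ≤ R) (hX : ∀ i < N, X i < X (i+1))
    (hr : ∀ i < N, 0 ≤ r i ∧ r i ≤ R) (y c : ℝ) (hc : 0 ≤ c) :
    0 ≤ cwsCum N r X (y + c) - cwsCum N r X y ∧
    cwsCum N r X (y + c) - cwsCum N r X y ≤ R * c := by
  let g : ℕ → ℝ := fun i => max (y + c - X i) 0 - max (y - X i) 0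
  have hg : ∀ i < N, g (i+1) ≤ g i := by
    intro i hi
    have := hX i hi
    simp only [g]
    rcases max_cases (y + c - X i) 0 with h1 | h1 <;> rcases max_cases (y - X i) 0 with h2 | h2 <;>
    rcases max_cases (y + c - X (i+1)) 0 with h3 | h3 <;>
    rcases max_cases (y - X (i+1)) 0 with h4 | h4 <;> linarith
  have e : cwsCum N r X (y + c) - cwsCum N r X y =
      ∑ i ∈ Finset.range N, r i * (g i - g (i+1)) := by
    unfold cwsCum
    rw [← Finset.sum_sub_distrib]
    refine Finset.sum_congr rfl fun i _ => ?_
    simp only [g]; ring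
  rw [e]
  constructor
  · refine Finset.sum_nonneg fun i hi => ?_
    have hi := Finset.mem_range.1 hi
    exact mul_nonneg (hr i hi).1 (sub_nonneg.2 (hg i hi))
  · refine (cws_tele N r g R (fun i hi => (hr i hi).2) hg).trans ?_
    have : g 0 - g N ≤ c := by
      simp only [g]
      rcases max_cases (y + c - X 0) 0 with h1 | h1 <;> rcases max_cases (y - X 0) 0 with h2 | h2 <;>
      rcases max_cases (y + c - X N) 0 with h3 | h3 <;>
      rcases max_cases (y - X N) 0 with h4 | h4 <;> linarith
    exact mul_le_mul_of_nonneg_left this hR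

lemma cws_cum_lip (N : ℕ) (r X : ℕ → ℝ) (R : ℝ) (hR : 0 ≤ R) (hX : ∀ i < N, X i < X (i+1))
    (hr : ∀ i < N, 0 ≤ r i ∧ r i ≤ R) (y z : ℝ) :
    |cwsCum N r X y - cwsCum N r X z| ≤ R * |y - z| := by
  rcases le_total z y with h | h
  · have := cws_cum_shift N r X R hR hX hr z (y - z) (by linarith)
    rw [add_sub_cancel] at this
    rw [abs_of_nonneg this.1, abs_of_nonneg (by linarith)]; exact this.2
  · have := cws_cum_shift N r X R hR hX hr y (z - y) (by linarith)
    rw [add_sub_cancel] at this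
    rw [abs_sub_comm, abs_of_nonneg this.1, abs_sub_comm, abs_of_nonneg (by linarith)]; exact this.2

lemma cws_clamp_mono (l r r' a b a' b' y c : ℝ) (hl : 0 < l) (hab : a < b) (hab' : a' < b')
    (hr : r * (b - a) = l) (hr' : r' * (b' - a') = l) (ha : a' ≤ a + c) (hb : b' ≤ b + c) :
    r * (max (y - a) 0 - max (y - b) 0) ≤ r' * (max (y + c - a') 0 - max (y + c - b') 0) := by
  have hr0 : 0 < r := by by_contra h; nlinarith
  have hr0' : 0 < r' := by by_contra h; nlinarith
  have hnn : 0 ≤ r' * (max (y + c - a') 0 - max (y + c - b') 0) := by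
    refine mul_nonneg hr0'.le (sub_nonneg.2 (max_le_max (by linarith) le_rfl))
  rcases le_or_gt y a with h1 | h1
  · rw [max_eq_right (by linarith : y - a ≤ 0), max_eq_right (by linarith : y - b ≤ 0)]
    simpa using hnn
  have hle : r * (max (y - a) 0 - max (y - b) 0) ≤ l := by
    rw [← hr]; refine mul_le_mul_of_nonneg_left ?_ hr0.le
    rcases max_cases (y - a) 0 with h1 | h1 <;> rcases max_cases (y - b) 0 with h2 | h2 <;> linarith
  rcases le_or_gt b' (y + c) with h2 | h2
  · refine hle.trans_eq ?_
    rw [max_eq_left (by linarith), max_eq_left (by linarith), ← hr']; ring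
  · have h3 : y < b := by linarith
    rw [max_eq_left (by linarith : 0 ≤ y - a), max_eq_right (by linarith : y - b ≤ 0),
      max_eq_left (by linarith : 0 ≤ y + c - a'), max_eq_right (by linarith : y + c - b' ≤ 0)]
    have e1 : r = l / (b - a) := by rw [eq_div_iff (by linarith)]; exact hr
    have e2 : r' = l / (b' - a') := by rw [eq_div_iff (by linarith)]; exact hr'
    rw [e1, e2, sub_zero, sub_zero, div_mul_eq_mul_div, div_mul_eq_mul_div,
      div_le_div_iff₀ (by linarith) (by linarith)]
    have : (y - a) * (b' - a') ≤ (y + c - a') * (b - a) := by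
      have p1 : 0 ≤ (y - a) * (b + c - b') := mul_nonneg (by linarith) (by linarith)
      have p2 : 0 ≤ (b - y) * (a + c - a') := mul_nonneg (by linarith) (by linarith)
      nlinarith
    nlinarith

lemma cws_cum_time (N : ℕ) (r X r' X' : ℕ → ℝ) (R l c : ℝ) (hR : 0 ≤ R) (hl : 0 < l) (hc : 0 ≤ c)
    (hX : ∀ i < N, X i < X (i+1)) (hX' : ∀ i < N, X' i < X' (i+1))
    (hr : ∀ i < N, 0 ≤ r i ∧ r i ≤ R) (hr' : ∀ i < N, 0 ≤ r' i ∧ r' i ≤ R)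
    (hrl : ∀ i < N, r i * (X (i+1) - X i) = l) (hrl' : ∀ i < N, r' i * (X' (i+1) - X' i) = l)
    (hXX : ∀ i ≤ N, |X' i - X i| ≤ c) (y : ℝ) :
    |cwsCum N r' X' y - cwsCum N r X y| ≤ R * c := by
  have h1 : cwsCum N r X y ≤ cwsCum N r' X' (y + c) := by
    refine Finset.sum_le_sum fun i hi => ?_
    have hi := Finset.mem_range.1 hi
    exact cws_clamp_mono l _ _ _ _ _ _ y c hl (hX i hi) (hX' i hi) (hrl i hi) (hrl' i hi)
      (by linarith [(abs_le.1 (hXX i hi.le)).2]) (by linarith [(abs_le.1 (hXX (i+1) hi)).2])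
  have h2 : cwsCum N r' X' y ≤ cwsCum N r X (y + c) := by
    refine Finset.sum_le_sum fun i hi => ?_
    have hi := Finset.mem_range.1 hi
    exact cws_clamp_mono l _ _ _ _ _ _ y c hl (hX' i hi) (hX i hi) (hrl' i hi) (hrl i hi)
      (by linarith [(abs_le.1 (hXX i hi.le)).1]) (by linarith [(abs_le.1 (hXX (i+1) hi)).1])
  have h3 := (cws_cum_shift N r X R hR hX hr y c hc).2
  have h4 := (cws_cum_shift N r' X' R hR hX' hr' y c hc).2
  rw [abs_le]; constructor <;> linarith

lemma cws_cum_bound (N : ℕ) (r X : ℕ → ℝ) (l : ℝ) (hX : ∀ i < N, X i < X (i+1))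
    (hr : ∀ i < N, 0 ≤ r i) (hrl : ∀ i < N, r i * (X (i+1) - X i) = l) (y : ℝ) :
    |cwsCum N r X y| ≤ N * l := by
  have h0 : 0 ≤ cwsCum N r X y := by
    refine Finset.sum_nonneg fun i hi => ?_
    have hi := Finset.mem_range.1 hi
    exact mul_nonneg (hr i hi) (sub_nonneg.2 (max_le_max (by linarith [hX i hi]) le_rfl))
  rw [abs_of_nonneg h0]
  calc cwsCum N r X y ≤ ∑ i ∈ Finset.range N, l := by
        refine Finset.sum_le_sum fun i hi => ?_
        have hi := Finset.mem_range.1 hi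
        rw [← hrl i hi]
        refine mul_le_mul_of_nonneg_left ?_ (hr i hi)
        have := hX i hi
        rcases max_cases (y - X i) 0 with h1 | h1 <;>
          rcases max_cases (y - X (i+1)) 0 with h2 | h2 <;> linarith
    _ = N * l := by simp


/-- Properties of the quantile points. -/
lemma cws_quantile (L R : ℝ) (ρb : ℝ → ℝ) (N : ℕ) (X : ℕ → ℝ) (hLpos : 0 < L) (hN : 0 < N)
    (hIntg : Integrable ρb)
    (hsupp : HasCompactSupport ρb)
    (hbound : ∀ᵐ z ∂(volume : Measure ℝ), ρb z ∈ Set.Icc 0 R)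
    (hLdef : (∫ z, ρb z) = L)
    (h0 : X 0 = sInf (tsupport ρb))
    (hq : ∀ i < N,
      IsLeast {z : ℝ | X i ≤ z ∧ L / N ≤ ∫ s in (X i)..z, ρb s} (X (i + 1))) :
    (∀ i < N, ∫ s in (X i)..(X (i+1)), ρb s = L / N) ∧
    (∀ i ≤ N, X i ≤ sSup (tsupport ρb)) ∧
    (∀ φ : ℝ → ℝ, Continuous φ → ∀ K, (∀ y, |φ y| ≤ K) → 
      ∫ z, ρb z * φ z = ∑ i ∈ Finset.range N, ∫ s in (X i)..(X (i+1)), ρb s * φ s) := by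
  have hl : 0 < L / N := by positivity
  have hne : (tsupport ρb).Nonempty := by
    by_contra h
    rw [Set.not_nonempty_iff_eq_empty, tsupport_eq_empty_iff] at h
    rw [h] at hLdef; simp at hLdef; linarith
  have hcpt : IsCompact (tsupport ρb) := hsupp
  set B := sSup (tsupport ρb) with hB
  have hX0B : X 0 ≤ B := by
    rw [h0]; obtain ⟨z, hz⟩ := hne
    exact (csInf_le hcpt.bddBelow hz).trans (le_csSup hcpt.bddAbove hz)
  have hout : ∀ z, z ∉ Set.Icc (X 0) B → ρb z = 0 := by
    intro z hz
    by_contra hc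
    apply hz
    have hz' : z ∈ tsupport ρb := subset_tsupport _ hc
    exact ⟨h0 ▸ csInf_le hcpt.bddBelow hz', le_csSup hcpt.bddAbove hz'⟩
  have hfull : ∀ φ : ℝ → ℝ, ∫ z, ρb z * φ z = ∫ z in (X 0)..B, ρb z * φ z := by
    intro φ
    rw [intervalIntegral.integral_of_le hX0B, ← integral_Icc_eq_integral_Ioc,
      setIntegral_eq_integral_of_forall_compl_eq_zero]
    intro z hz; rw [hout z hz, zero_mul]
  have hfull1 : ∫ z in (X 0)..B, ρb z = L := by
    have := hfull (fun _ => 1)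
    simp only [mul_one] at this
    rw [← this, hLdef]
  have hii : ∀ a b, IntervalIntegrable ρb volume a b := fun a b => hIntg.intervalIntegrable
  have hcell : ∀ i < N, ∫ s in (X i)..(X (i+1)), ρb s = L / N := by
    intro i hi
    obtain ⟨⟨hm1, hm2⟩, hlow⟩ := hq i hi
    refine le_antisymm ?_ hm2
    have hcont : ContinuousOn (fun z => ∫ s in (X i)..z, ρb s) (Set.Icc (X i) (X (i+1))) :=
      (intervalIntegral.continuous_primitive hii _).continuousOn
    have := intermediate_value_Icc hm1 hcont
    have hmem : L / N ∈ Set.Icc (∫ s in (X i)..(X i), ρb s) (∫ s in (X i)..(X (i+1)), ρb s) := by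
      rw [intervalIntegral.integral_same]; exact ⟨hl.le, hm2⟩
    obtain ⟨z, hz, hzeq⟩ := this hmem
    have h1 : X (i+1) ≤ z := hlow ⟨hz.1, hzeq.ge⟩
    have h2 : z = X (i+1) := le_antisymm hz.2 h1
    rw [← h2]; exact hzeq.le
  have hsum : ∀ i ≤ N, ∫ s in (X 0)..(X i), ρb s = i * (L / N) := by
    intro i hi
    rw [← intervalIntegral.sum_integral_adjacent_intervals (fun k _ => hii _ _),
      Finset.sum_congr rfl (fun k hk => hcell k (by have := Finset.mem_range.1 hk; omega))]
    simp
  have hrest : ∀ i ≤ N, ∫ s in (X i)..B, ρb s = L - i * (L / N) := by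
    intro i hi
    have := intervalIntegral.integral_add_adjacent_intervals (hii (X 0) (X i)) (hii (X i) B)
    rw [hsum i hi, hfull1] at this; linarith
  have hXB : ∀ i ≤ N, X i ≤ B := by
    intro i
    induction i with
    | zero => intro _; exact hX0B
    | succ i ih =>
      intro hi
      refine (hq i (by omega)).2 ⟨ih (by omega), ?_⟩
      rw [hrest i (by omega)]
      have : ((i:ℝ) + 1) ≤ N := by exact_mod_cast hi
      have hN' : (0:ℝ) < N := by exact_mod_cast hN
      have e : L = N * (L / N) := by field_simp
      nlinarith
  refine ⟨hcell, hXB, ?_⟩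
  intro φ hφ K hK
  rw [hfull φ]
  have hiφ : ∀ a b, IntervalIntegrable (fun s => ρb s * φ s) volume a b := by
    intro a b
    refine (Integrable.mul_bdd (c := K) hIntg hφ.aestronglyMeasurable ?_).intervalIntegrable
    exact Eventually.of_forall hK
  rw [intervalIntegral.sum_integral_adjacent_intervals (fun k _ => hiφ _ _),
    ← intervalIntegral.integral_add_adjacent_intervals (hiφ (X 0) (X N)) (hiφ (X N) B)]
  have hz : ∫ s in (X N)..B, ρb s * φ s = 0 := by
    have h1 : ‖∫ s in (X N)..B, ρb s * φ s‖ ≤ ∫ s in (X N)..B, K * ρb s := by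
      refine intervalIntegral.norm_integral_le_of_norm_le (hXB N le_rfl) ?_ ((hii _ _).const_mul _)
      filter_upwards [hbound] with z hz _
      rw [norm_mul, Real.norm_of_nonneg hz.1, mul_comm]
      exact mul_le_mul_of_nonneg_right (hK z) hz.1
    rw [intervalIntegral.integral_const_mul, hrest N le_rfl] at h1
    have hN' : (0:ℝ) < N := by exact_mod_cast hN
    have e : L - N * (L / N) = 0 := by field_simp; ring
    rw [e, mul_zero] at h1
    exact norm_le_zero_iff.1 h1
  rw [hz, add_zero]

/-- Bound of the initial total variation. -/
lemma cws_init_tv (l R : ℝ) (ρb : ℝ → ℝ) (N : ℕ) (X r : ℕ → ℝ)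
    (hIntg : Integrable ρb) (hBV : BoundedVariationOn ρb Set.univ)
    (hX : ∀ i < N, X i < X (i+1))
    (hcell : ∀ i < N, ∫ s in (X i)..(X (i+1)), ρb s = l)
    (hr : ∀ i < N, r i * (X (i+1) - X i) = l)
    (hrb : ∀ i < N, 0 < r i ∧ r i ≤ R) (hR : 0 ≤ R) (hrN : r N = 0) :
    ∑ i ∈ Finset.range N, |r (i+1) - r i| ≤ (eVariationOn ρb Set.univ).toReal + R := by
  rcases Nat.eq_zero_or_pos N with h0 | h0
  · subst h0; simp; positivity
  obtain ⟨n, rfl⟩ : ∃ n, N = n + 1 := ⟨N - 1, by omega⟩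
  rw [Finset.sum_range_succ]
  have hlast : |r (n+1) - r n| ≤ R := by
    rw [hrN, zero_sub, abs_neg, abs_of_pos (hrb n (by omega)).1]; exact (hrb n (by omega)).2
  refine add_le_add ?_ hlast
  let p : ℕ → ℝ → ℝ := fun i s => X i + (X (i+1) - X i) * s
  have hav : ∀ i < n + 1, r i = ∫ s in (0:ℝ)..1, ρb (p i s) := by
    intro i hi
    have hd : X (i+1) - X i ≠ 0 := by have := hX i hi; intro h; linarith
    simp only [p]
    rw [intervalIntegral.integral_comp_add_mul _ hd]
    simp only [mul_zero, add_zero, mul_one, add_sub_cancel]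
    rw [hcell i hi, ← hr i hi, smul_eq_mul]
    field_simp
  have hpi : ∀ i < n + 1, IntervalIntegrable (fun s => ρb (p i s)) volume 0 1 := by
    intro i hi
    have hd : X (i+1) - X i ≠ 0 := by have := hX i hi; intro h; linarith
    have := (hIntg.comp_add_left (X i)).comp_mul_left' hd
    exact this.intervalIntegrable
  calc ∑ i ∈ Finset.range n, |r (i+1) - r i|
      ≤ ∑ i ∈ Finset.range n, ∫ s in (0:ℝ)..1, |ρb (p (i+1) s) - ρb (p i s)| := by
        refine Finset.sum_le_sum fun i hi => ?_
        have hi := Finset.mem_range.1 hi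
        rw [hav i (by omega), hav (i+1) (by omega),
          ← intervalIntegral.integral_sub (hpi _ (by omega)) (hpi _ (by omega))]
        exact intervalIntegral.abs_integral_le_integral_abs zero_le_one
    _ = ∫ s in (0:ℝ)..1, ∑ i ∈ Finset.range n, |ρb (p (i+1) s) - ρb (p i s)| := by
        rw [intervalIntegral.integral_finsetSum]
        intro i hi
        have hi := Finset.mem_range.1 hi
        exact ((hpi _ (by omega)).sub (hpi _ (by omega))).abs
    _ ≤ ∫ s in (0:ℝ)..1, (eVariationOn ρb Set.univ).toReal := by
        refine intervalIntegral.integral_mono_on zero_le_one ?_ (by simp) ?_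
        · have : ∀ i ∈ Finset.range n, IntervalIntegrable
              (fun s => |ρb (p (i+1) s) - ρb (p i s)|) volume 0 1 := by
            intro i hi
            have hi := Finset.mem_range.1 hi
            exact ((hpi _ (by omega)).sub (hpi _ (by omega))).abs
          have h2 := IntervalIntegrable.sum _ this
          refine h2.congr (fun s _ => ?_)
          simp
        · intro s hs
          have hle : ∀ i, i < n → p i s ≤ p (i+1) s := by
            intro i hi
            simp only [p]
            have h1 := hX i (by omega)
            have h2 := hX (i+1) (by omega)
            have h3 : (X (i+1) - X i) * s ≤ (X (i+1) - X i) := by nlinarith [hs.2]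
            have h4 : 0 ≤ (X (i+1+1) - X (i+1)) * s := by
              refine mul_nonneg (by linarith) hs.1
            linarith
          have hmono : MonotoneOn (fun i => p i s) (Set.Iic n) := by
            intro i hi j hj hij
            simp only [Set.mem_Iic] at hi hj
            induction j, hij using Nat.le_induction with
            | base => exact le_rfl
            | succ j hij ih => exact (ih (by omega)).trans (hle j (by omega))
          have hv := eVariationOn.sum_le_of_monotoneOn_Iic (f := ρb) (s := Set.univ) hmono
            (fun _ _ => Set.mem_univ _)
          have := ENNReal.toReal_mono hBV hv
          rw [ENNReal.toReal_sum (fun i _ => edist_ne_top _ _)] at this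
          simpa [← dist_edist, Real.dist_eq, edist_dist] using this
    _ = _ := by simp

/-- Convergence of the initial datum. -/
lemma cws_init_conv (L R K b Bd : ℝ) (ρb : ℝ → ℝ) (N : ℕ) (X : ℕ → ℝ) (hLpos : 0 < L) (hN : 0 < N)
    (hIntg : Integrable ρb)
    (hsupp : HasCompactSupport ρb)
    (hbound : ∀ᵐ z ∂(volume : Measure ℝ), ρb z ∈ Set.Icc 0 R)
    (hLdef : (∫ z, ρb z) = L)
    (h0 : X 0 = sInf (tsupport ρb))
    (hX : ∀ i < N, X i < X (i+1))
    (hq : ∀ i < N,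
      IsLeast {z : ℝ | X i ≤ z ∧ L / N ≤ ∫ s in (X i)..z, ρb s} (X (i + 1)))
    (φ : ℝ → ℝ) (hφ : Continuous φ) (hb : ∀ y, |φ y| ≤ b) (hK0 : 0 ≤ K)
    (hK : ∀ y z, |φ y - φ z| ≤ K * |y - z|) (hBd : sSup (tsupport ρb) - sInf (tsupport ρb) ≤ Bd) :
    |(∫ z, ρb z * φ z) - ∑ i ∈ Finset.range N, 
      L / N * ∫ s in (0:ℝ)..1, φ (X i + (X (i+1) - X i) * s)| ≤ 2 * K * Bd * (L / N) := by
  obtain ⟨hcell, hXB, hφi⟩ := cws_quantile L R ρb N X hLpos hN hIntg hsupp hbound hLdef h0 hq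
  have hl : 0 < L / N := by positivity
  rw [hφi φ hφ b hb, ← Finset.sum_sub_distrib]
  have hii : ∀ a b, IntervalIntegrable ρb volume a b := fun a b => hIntg.intervalIntegrable
  have hiφ : ∀ a c, IntervalIntegrable (fun s => ρb s * φ s) volume a c := by
    intro a c
    refine (Integrable.mul_bdd (c := b) hIntg hφ.aestronglyMeasurable ?_).intervalIntegrable
    exact Eventually.of_forall hb
  have key : ∀ i ∈ Finset.range N, |(∫ s in (X i)..(X (i+1)), ρb s * φ s) - 
      L / N * ∫ s in (0:ℝ)..1, φ (X i + (X (i+1) - X i) * s)| ≤ 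
      2 * K * (L / N) * (X (i+1) - X i) := by
    intro i hi
    have hi := Finset.mem_range.1 hi
    have hd := hX i hi
    have h1 : |(∫ s in (X i)..(X (i+1)), ρb s * φ s) - L / N * φ (X i)| ≤ 
        (L / N) * (K * (X (i+1) - X i)) := by
      rw [← hcell i hi, ← intervalIntegral.integral_mul_const, 
        ← intervalIntegral.integral_sub (hiφ _ _) ((hii _ _).mul_const _), 
        ← intervalIntegral.integral_mul_const, ← Real.norm_eq_abs]
      refine intervalIntegral.norm_integral_le_of_norm_le hd.le ?_ ((hii _ _).mul_const _)
      filter_upwards [hbound] with z hz hzm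
      rw [← mul_sub, norm_mul, Real.norm_of_nonneg hz.1]
      refine mul_le_mul_of_nonneg_left ((hK _ _).trans ?_) hz.1
      rw [abs_of_nonneg (by linarith [hzm.1])]
      exact mul_le_mul_of_nonneg_left (by linarith [hzm.2]) hK0
    have h2 : |L / N * (∫ s in (0:ℝ)..1, φ (X i + (X (i+1) - X i) * s)) - L / N * φ (X i)| ≤ 
        (L / N) * (K * (X (i+1) - X i)) := by
      rw [← mul_sub, abs_mul, abs_of_pos hl]
      refine mul_le_mul_of_nonneg_left ?_ hl.le
      have e : φ (X i) = ∫ s in (0:ℝ)..1, φ (X i) := by simp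
      rw [e, ← intervalIntegral.integral_sub (Continuous.intervalIntegrable (by fun_prop) _ _) 
        (by simp)]
      have := intervalIntegral.norm_integral_le_of_norm_le_const (a := 0) (b := 1) 
        (f := fun s => φ (X i + (X (i+1) - X i) * s) - φ (X i)) (C := K * (X (i+1) - X i)) ?_
      · simpa using this
      · intro s hs
        rw [Set.uIoc_of_le zero_le_one] at hs
        refine (hK _ _).trans (mul_le_mul_of_nonneg_left ?_ hK0)
        have : 0 ≤ (X (i+1) - X i) * s := mul_nonneg (by linarith) hs.1.le
        rw [add_sub_cancel_left, abs_of_nonneg this]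
        nlinarith [hs.2]
    rw [abs_le] at h1 h2 ⊢
    constructor <;> linarith
  refine (Finset.abs_sum_le_sum_abs _ _).trans ((Finset.sum_le_sum key).trans ?_)
  rw [← Finset.mul_sum, Finset.sum_range_sub]
  have h1 := hXB N le_rfl
  have h2 : X N - X 0 ≤ Bd := by rw [h0]; linarith
  have : 2 * K * (L/N) * (X N - X 0) ≤ 2 * K * (L/N) * Bd := mul_le_mul_of_nonneg_left h2 (by positivity)
  linarith


/-- Everything we need about one particle configuration. -/
structure CwsCfg (R Lv C A B θ : ℝ) (v : ℝ → ℝ) (N M : ℕ) (l τ : ℝ) (x : ℕ → ℕ → ℝ) : Prop where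
  hl : 0 < l
  hτ : 0 < τ
  mono : ∀ m ≤ M, ∀ i < N, x i m < x (i+1) m
  rb : ∀ m ≤ M, ∀ i < N, 0 < Rd N l x i m ∧ Rd N l x i m ≤ R
  rN : ∀ m, Rd N l x N m = 0
  rl : ∀ m ≤ M, ∀ i < N, Rd N l x i m * (x (i+1) m - x i m) = l
  step : ∀ m < M, ∀ i ≤ N, x i (m+1) = x i m +
    τ * (θ * v (Rd N l x i m) + (1 - θ) * v (Rd N l x i (m+1)))
  tv : ∀ m ≤ M, Rd N l x 0 m +
    ∑ i ∈ Finset.range N, |Rd N l x (i+1) m - Rd N l x i m| ≤ C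
  lo : ∀ m ≤ M, A ≤ x 0 m
  hi : ∀ m ≤ M, x N m ≤ B

lemma cws_disc_eq (N M : ℕ) (l τ : ℝ) (x : ℕ → ℕ → ℝ) (hτ : 0 < τ) (m : ℕ) (hm : m < M)
    (y t : ℝ) (ht : t ∈ Set.Ico ((m:ℝ) * τ) (((m:ℝ) + 1) * τ)) :
    discDens N M l τ x y t = cwsDens N (fun i => Rd N l x i m) (fun i => x i m) y := by
  unfold discDens cwsDens
  rw [Finset.sum_eq_single m]
  · refine Finset.sum_congr rfl fun i _ => ?_
    rw [Set.indicator_of_mem ht, mul_one]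
  · intro k _ hkm
    refine Finset.sum_eq_zero fun i _ => ?_
    rw [Set.indicator_of_notMem (s := Set.Ico ((k:ℝ) * τ) (((k:ℝ) + 1) * τ)), mul_zero]
    rintro ⟨h1, h2⟩
    apply hkm
    have h3 : (m:ℝ) < k + 1 := by
      by_contra hc; push Not at hc
      have := mul_le_mul_of_nonneg_right hc hτ.le
      linarith [ht.1]
    have h4 : (k:ℝ) < m + 1 := by
      by_contra hc; push Not at hc
      have := mul_le_mul_of_nonneg_right hc hτ.le
      linarith [ht.2]
    have h3' : m < k + 1 := by exact_mod_cast h3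
    have h4' : k < m + 1 := by exact_mod_cast h4
    omega
  · intro h; exact absurd (Finset.mem_range.2 hm) h

lemma cws_cell_unique (N : ℕ) (X : ℕ → ℝ) (hX : ∀ i < N, X i < X (i+1)) (i j : ℕ) (hi : i < N)
    (hj : j < N) (y : ℝ) (h1 : y ∈ Set.Ico (X i) (X (i+1))) (h2 : y ∈ Set.Ico (X j) (X (j+1))) :
    i = j := by
  rcases lt_trichotomy i j with h | h | h
  · have := cws_mono_X N X hX j hj.le (i+1) h
    linarith [h1.2, h2.1]
  · exact h
  · have := cws_mono_X N X hX i hi.le (j+1) h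
    linarith [h1.1, h2.2]

lemma cws_inner (N : ℕ) (l : ℝ) (r X : ℕ → ℝ) (v ψ1 ψ2 : ℝ → ℝ) (hX : ∀ i < N, X i < X (i+1))
    (hrl : ∀ i < N, r i * (X (i+1) - X i) = l)
    (h1 : Continuous ψ1) (h2 : Continuous ψ2) :
    ∫ y, (cwsDens N r X y * ψ1 y + cwsDens N r X y * v (cwsDens N r X y) * ψ2 y) =
    ∑ i ∈ Finset.range N, l * ∫ s in (0:ℝ)..1,
      (ψ1 (X i + (X (i+1) - X i) * s) + v (r i) * ψ2 (X i + (X (i+1) - X i) * s)) := by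
  have hpt : ∀ y, cwsDens N r X y * ψ1 y + cwsDens N r X y * v (cwsDens N r X y) * ψ2 y =
      ∑ i ∈ Finset.range N, Set.indicator (Set.Ico (X i) (X (i+1)))
        (fun y => r i * (ψ1 y + v (r i) * ψ2 y)) y := by
    intro y
    by_cases hy : ∃ j < N, y ∈ Set.Ico (X j) (X (j+1))
    · obtain ⟨j, hj, hyj⟩ := hy
      have hd : cwsDens N r X y = r j := by
        unfold cwsDens
        rw [Finset.sum_eq_single j]
        · rw [Set.indicator_of_mem hyj, mul_one]
        · intro i hi hij
          rw [Set.indicator_of_notMem, mul_zero]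
          exact fun hyi => hij (cws_cell_unique N X hX i j (Finset.mem_range.1 hi) hj y hyi hyj)
        · intro h; exact absurd (Finset.mem_range.2 hj) h
      rw [hd, Finset.sum_eq_single j]
      · rw [Set.indicator_of_mem hyj]; ring
      · intro i hi hij
        rw [Set.indicator_of_notMem]
        exact fun hyi => hij (cws_cell_unique N X hX i j (Finset.mem_range.1 hi) hj y hyi hyj)
      · intro h; exact absurd (Finset.mem_range.2 hj) h
    · push Not at hy
      have hd : cwsDens N r X y = 0 := by
        unfold cwsDens
        refine Finset.sum_eq_zero fun i hi => ?_
        rw [Set.indicator_of_notMem (hy i (Finset.mem_range.1 hi)), mul_zero]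
      rw [hd, Finset.sum_eq_zero]
      · ring
      · intro i hi
        rw [Set.indicator_of_notMem (hy i (Finset.mem_range.1 hi))]
  simp_rw [hpt]
  have hc : ∀ i, Continuous (fun y => r i * (ψ1 y + v (r i) * ψ2 y)) := fun i => by fun_prop
  rw [integral_finsetSum]
  · refine Finset.sum_congr rfl fun i hi => ?_
    have hi := Finset.mem_range.1 hi
    have hd := hX i hi
    rw [integral_indicator measurableSet_Ico, integral_Ico_eq_integral_Ioc,
      ← intervalIntegral.integral_of_le hd.le, intervalIntegral.integral_const_mul]
    have := intervalIntegral.smul_integral_comp_add_mul (a := 0) (b := 1)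
      (f := fun y => ψ1 y + v (r i) * ψ2 y) (X (i+1) - X i) (X i)
    simp only [mul_zero, add_zero, mul_one, add_sub_cancel, smul_eq_mul] at this
    rw [← this, ← mul_assoc, hrl i hi]
  · intro i _
    rw [integrable_indicator_iff measurableSet_Ico]
    exact ((hc i).integrableOn_Icc).mono_set Set.Ico_subset_Icc_self

/-- Pointwise consistency along a label. -/
lemma cws_pt (φ φt φx : ℝ → ℝ → ℝ) (Kx ω c τ t0 y0 u w : ℝ) (hτ : 0 < τ) 
    (hct : Continuous (Function.uncurry φt)) (hcx : Continuous (Function.uncurry φx))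
    (hdt : ∀ y t, HasDerivAt (fun s => φ y s) (φt y t) t)
    (hdx : ∀ y t, HasDerivAt (fun z => φ z t) (φx y t) y)
    (hKx : ∀ y t, |φx y t| ≤ Kx)
    (hω : ∀ y z t s, |y - z| ≤ c * τ → |t - s| ≤ τ → |φx y t - φx z s| ≤ ω)
    (hu : |u| ≤ c) (hw : |w| ≤ c) :
    |φ (y0 + τ * u) (t0 + τ) - φ y0 t0 - ∫ t in t0..(t0 + τ), (φt y0 t + w * φx y0 t)| ≤
      τ * (|u - w| * Kx + c * ω) := by
  have c1 : Continuous (fun t => φt y0 t) := hct.comp (by fun_prop : Continuous fun t : ℝ => (y0, t))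
  have c2 : Continuous (fun t => φx y0 t) := hcx.comp (by fun_prop : Continuous fun t : ℝ => (y0, t))
  have c3 : Continuous (fun t => φx (y0 + (t - t0) * u) (t0 + τ)) :=
    hcx.comp (by fun_prop : Continuous fun t : ℝ => (y0 + (t - t0) * u, t0 + τ))
  have e1 : ∫ t in t0..(t0 + τ), φt y0 t = φ y0 (t0 + τ) - φ y0 t0 :=
    intervalIntegral.integral_eq_sub_of_hasDerivAt (fun t _ => hdt y0 t) (c1.intervalIntegrable _ _)
  have e2 : ∫ t in t0..(t0 + τ), φx (y0 + (t - t0) * u) (t0 + τ) * u =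
      φ (y0 + τ * u) (t0 + τ) - φ y0 (t0 + τ) := by
    have := intervalIntegral.integral_eq_sub_of_hasDerivAt (a := t0) (b := t0 + τ)
      (f := fun t => φ (y0 + (t - t0) * u) (t0 + τ))
      (f' := fun t => φx (y0 + (t - t0) * u) (t0 + τ) * u) (fun t _ => ?_)
      ((c3.mul continuous_const).intervalIntegrable _ _)
    · simpa using this
    · have hg : HasDerivAt (fun t : ℝ => y0 + (t - t0) * u) u t := by
        simpa using (((hasDerivAt_id t).sub_const t0).mul_const u).const_add y0
      exact (hdx (y0 + (t - t0) * u) (t0 + τ)).comp t hg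
  have e3 : φ (y0 + τ * u) (t0 + τ) - φ y0 t0 - ∫ t in t0..(t0 + τ), (φt y0 t + w * φx y0 t) =
      ∫ t in t0..(t0 + τ), (φx (y0 + (t - t0) * u) (t0 + τ) * u - w * φx y0 t) := by
    have c2' : Continuous (fun t => w * φx y0 t) := continuous_const.mul c2
    have c3' : Continuous (fun t => φx (y0 + (t - t0) * u) (t0 + τ) * u) := c3.mul continuous_const
    rw [intervalIntegral.integral_add (c1.intervalIntegrable _ _)
      (c2'.intervalIntegrable _ _), intervalIntegral.integral_sub
      (c3'.intervalIntegrable _ _) (c2'.intervalIntegrable _ _), e1, e2]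
    ring
  rw [e3]
  have := intervalIntegral.norm_integral_le_of_norm_le_const (a := t0) (b := t0 + τ)
    (f := fun t => (φx (y0 + (t - t0) * u) (t0 + τ) * u - w * φx y0 t))
    (C := |u - w| * Kx + c * ω) ?_
  · rw [add_sub_cancel_left, abs_of_pos hτ, mul_comm] at this
    exact this
  · intro t ht
    rw [Set.uIoc_of_le (by linarith)] at ht
    have hcn : 0 ≤ c := (abs_nonneg _).trans hw
    have h1 := hω (y0 + (t - t0) * u) y0 (t0 + τ) t (by
      rw [add_sub_cancel_left, abs_mul, abs_of_nonneg (by linarith [ht.1]), mul_comm]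
      exact mul_le_mul hu (by linarith [ht.2]) (by linarith [ht.1]) hcn) (by rw [abs_of_nonneg (by linarith [ht.2])]; linarith [ht.1])
    have e4 : φx (y0 + (t - t0) * u) (t0 + τ) * u - w * φx y0 t =
      (u - w) * φx (y0 + (t - t0) * u) (t0 + τ) + w * (φx (y0 + (t - t0) * u) (t0 + τ) - φx y0 t) := by
      ring
    rw [e4, Real.norm_eq_abs]
    refine (abs_add_le _ _).trans ?_
    rw [abs_mul, abs_mul]
    have := hKx (y0 + (t - t0) * u) (t0 + τ)
    gcongr

/-- Weak consistency of the scheme. -/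
lemma cws_weak (R Lv C A B θ c T L Kx ω : ℝ) (v : ℝ → ℝ) (N M : ℕ) (l τ : ℝ) (x : ℕ → ℕ → ℝ)
    (H : CwsCfg R Lv C A B θ v N M l τ x) (hR : 0 < R)
    (hθ0 : 0 ≤ θ) (hθ1 : θ ≤ 1) (hLv0 : 0 ≤ Lv)
    (hLv : ∀ a ∈ Set.Icc (0 : ℝ) R, ∀ b ∈ Set.Icc (0 : ℝ) R, |v a - v b| ≤ Lv * |a - b|)
    (hc : ∀ a ∈ Set.Icc (0 : ℝ) R, |v a| ≤ c)
    (hMT : M * τ = T) (hNL : N * l = L)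
    (φ φt φx : ℝ → ℝ → ℝ)
    (hcφ : Continuous (Function.uncurry φ))
    (hct : Continuous (Function.uncurry φt)) (hcx : Continuous (Function.uncurry φx))
    (hdt : ∀ y t, HasDerivAt (fun s => φ y s) (φt y t) t)
    (hdx : ∀ y t, HasDerivAt (fun z => φ z t) (φx y t) y)
    (hKx : ∀ y t, |φx y t| ≤ Kx)
    (hω : ∀ y z t s, |y - z| ≤ c * τ → |t - s| ≤ τ → |φx y t - φx z s| ≤ ω)
    (hφT : ∀ y, φ y T = 0) :
    |(∫ t in (0:ℝ)..T, ∫ y, (discDens N M l τ x y t * φt y t +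
        discDens N M l τ x y t * v (discDens N M l τ x y t) * φx y t)) +
      ∑ i ∈ Finset.range N, l * ∫ s in (0:ℝ)..1, φ (x i 0 + (x (i+1) 0 - x i 0) * s) 0| ≤
    T * (Kx * (Lv * (R^2 * τ * Lv * (2 * C)) + Lv * l * (2 * C)) + L * c * ω) := by
  have hτ := H.hτ
  have hl := H.hl
  have hKx0 : 0 ≤ Kx := (abs_nonneg _).trans (hKx 0 0)
  let r : ℕ → ℕ → ℝ := fun i m => Rd N l x i m
  let g : ℕ → ℝ → ℝ := fun m t => ∑ i ∈ Finset.range N, l * ∫ s in (0:ℝ)..1,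
      (φt (x i m + (x (i+1) m - x i m) * s) t + v (r i m) * φx (x i m + (x (i+1) m - x i m) * s) t)
  let P : ℕ → ℝ := fun m => ∑ i ∈ Finset.range N, l * ∫ s in (0:ℝ)..1,
    φ (x i m + (x (i+1) m - x i m) * s) (m * τ)
  have rmem : ∀ m ≤ M, ∀ i ≤ N, r i m ∈ Set.Icc 0 R := by
    intro m hm i hi
    rcases Nat.lt_or_ge i N with h | h
    · exact ⟨(H.rb m hm i h).1.le, (H.rb m hm i h).2⟩
    · have : i = N := le_antisymm hi h
      simp only [r]; rw [this, H.rN]; exact ⟨le_rfl, hR.le⟩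
  have hψc : ∀ i m, Continuous (Function.uncurry fun t s =>
      (φt (x i m + (x (i+1) m - x i m) * s) t +
        v (r i m) * φx (x i m + (x (i+1) m - x i m) * s) t)) := by
    intro i m
    have k1 := hct.comp (by fun_prop : Continuous fun p : ℝ × ℝ =>
      (x i m + (x (i+1) m - x i m) * p.2, p.1))
    have k2 := hcx.comp (by fun_prop : Continuous fun p : ℝ × ℝ =>
      (x i m + (x (i+1) m - x i m) * p.2, p.1))
    exact k1.add (continuous_const.mul k2)
  have hgi : ∀ i m, Continuous (fun t => ∫ s in (0:ℝ)..1,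
      (φt (x i m + (x (i+1) m - x i m) * s) t +
        v (r i m) * φx (x i m + (x (i+1) m - x i m) * s) t)) := fun i m =>
    intervalIntegral.continuous_parametric_intervalIntegral_of_continuous' (hψc i m) 0 1
  have hgc : ∀ m, Continuous (g m) := fun m =>
    continuous_finsetSum _ fun i _ => continuous_const.mul (hgi i m)
  -- the inner integral
  have hF : ∀ m < M, Set.EqOn (g m) (fun t => ∫ y, (discDens N M l τ x y t * φt y t +
        discDens N M l τ x y t * v (discDens N M l τ x y t) * φx y t))
        (Set.uIoo ((m:ℝ) * τ) (((m + 1 : ℕ):ℝ) * τ)) := by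
    intro m hm t ht
    have hlt : (m:ℝ) * τ ≤ ((m + 1 : ℕ):ℝ) * τ := by push_cast; nlinarith
    rw [Set.uIoo_of_le hlt] at ht
    have ht' : t ∈ Set.Ico ((m:ℝ) * τ) (((m:ℝ) + 1) * τ) := ⟨ht.1.le, by have := ht.2; push_cast at this; exact this⟩
    simp only [cws_disc_eq N M l τ x hτ m hm _ t ht']
    rw [cws_inner N l (fun i => Rd N l x i m) (fun i => x i m) v (fun y => φt y t) (fun y => φx y t)
      (H.mono m hm.le) (H.rl m hm.le)
      (hct.comp (by fun_prop : Continuous fun y : ℝ => (y, t)))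
      (hcx.comp (by fun_prop : Continuous fun y : ℝ => (y, t)))]
  have hsplit : (∫ t in (0:ℝ)..T, ∫ y, (discDens N M l τ x y t * φt y t +
        discDens N M l τ x y t * v (discDens N M l τ x y t) * φx y t)) =
      ∑ m ∈ Finset.range M, ∫ t in ((m:ℝ) * τ)..(((m + 1 : ℕ):ℝ) * τ), g m t := by
    have := intervalIntegral.sum_integral_adjacent_intervals (μ := volume) (n := M)
      (a := fun m : ℕ => (m:ℝ) * τ) (f := fun t => ∫ y, (discDens N M l τ x y t * φt y t +
        discDens N M l τ x y t * v (discDens N M l τ x y t) * φx y t))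
      (fun m hm => ((hgc m).intervalIntegrable _ _).congr_uIoo (hF m hm))
    simp only [Nat.cast_zero, zero_mul, hMT] at this
    rw [← this]
    refine Finset.sum_congr rfl fun m hm => ?_
    exact (intervalIntegral.integral_congr_uIoo (hF m (Finset.mem_range.1 hm))).symm
  have hstep : ∀ m ∈ Finset.range M,
      |P (m+1) - P m - ∫ t in ((m:ℝ) * τ)..(((m + 1 : ℕ):ℝ) * τ), g m t| ≤
      τ * (Kx * (Lv * (R^2 * τ * Lv * (2 * C)) + Lv * l * (2 * C)) + L * c * ω) := by
    intro m hm
    have hm := Finset.mem_range.1 hm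
    have hm1 : m + 1 ≤ M := hm
    have et : ((m + 1 : ℕ):ℝ) * τ = m * τ + τ := by push_cast; ring
    let D : ℕ → ℝ := fun i => Lv * |r i (m+1) - r i m| +
      Lv * (|r (i+1) m - r i m| + |r (i+1) (m+1) - r i (m+1)|)
    have hi_est : ∀ i ∈ Finset.range N,
        |(l * ∫ s in (0:ℝ)..1, φ (x i (m+1) + (x (i+1) (m+1) - x i (m+1)) * s) (m * τ + τ)) -
          (l * ∫ s in (0:ℝ)..1, φ (x i m + (x (i+1) m - x i m) * s) (m * τ)) -
          ∫ t in ((m:ℝ) * τ)..(m * τ + τ), l * ∫ s in (0:ℝ)..1,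
          (φt (x i m + (x (i+1) m - x i m) * s) t +
            v (r i m) * φx (x i m + (x (i+1) m - x i m) * s) t)| ≤
          l * (τ * (D i * Kx + c * ω)) := by
      intro i hi
      have hi := Finset.mem_range.1 hi
      rw [intervalIntegral.integral_const_mul, ← mul_sub, ← mul_sub, abs_mul, abs_of_pos hl]
      refine mul_le_mul_of_nonneg_left ?_ hl.le
      rw [intervalIntegral_intervalIntegral_swap (by
        refine ((hψc i m).integrableOn_Icc (a := (min (m*τ) (m*τ+τ), min 0 1))
          (b := (max (m*τ) (m*τ+τ), max 0 1))).mono_set ?_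
        rintro ⟨a, b⟩ ⟨h1, h2⟩
        exact ⟨⟨h1.1.le, h2.1.le⟩, ⟨h1.2, h2.2⟩⟩)]
      have k1 : Continuous (fun s => φ (x i (m+1) + (x (i+1) (m+1) - x i (m+1)) * s) (m * τ + τ)) :=
        hcφ.comp (by fun_prop : Continuous fun s : ℝ =>
          (x i (m+1) + (x (i+1) (m+1) - x i (m+1)) * s, m * τ + τ))
      have k2 : Continuous (fun s => φ (x i m + (x (i+1) m - x i m) * s) (m * τ)) :=
        hcφ.comp (by fun_prop : Continuous fun s : ℝ => (x i m + (x (i+1) m - x i m) * s, m * τ))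
      have k3 : Continuous (fun s => ∫ t in ((m:ℝ) * τ)..(m * τ + τ),
          (φt (x i m + (x (i+1) m - x i m) * s) t +
            v (r i m) * φx (x i m + (x (i+1) m - x i m) * s) t)) := by
        have hsw : Continuous (Function.uncurry fun s t =>
          (φt (x i m + (x (i+1) m - x i m) * s) t +
            v (r i m) * φx (x i m + (x (i+1) m - x i m) * s) t)) :=
          (hψc i m).comp continuous_swap
        exact intervalIntegral.continuous_parametric_intervalIntegral_of_continuous' hsw _ _
      have k12 : Continuous (fun s =>
          φ (x i (m+1) + (x (i+1) (m+1) - x i (m+1)) * s) (m * τ + τ) -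
          φ (x i m + (x (i+1) m - x i m) * s) (m * τ)) := k1.sub k2
      rw [← intervalIntegral.integral_sub (k1.intervalIntegrable _ _) (k2.intervalIntegrable _ _),
        ← intervalIntegral.integral_sub (k12.intervalIntegrable _ _) (k3.intervalIntegrable _ _)]
      have := intervalIntegral.norm_integral_le_of_norm_le_const (a := 0) (b := 1)
        (f := fun s => φ (x i (m+1) + (x (i+1) (m+1) - x i (m+1)) * s) (m * τ + τ) -
          φ (x i m + (x (i+1) m - x i m) * s) (m * τ) - ∫ t in ((m:ℝ) * τ)..(m * τ + τ),
          (φt (x i m + (x (i+1) m - x i m) * s) t +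
            v (r i m) * φx (x i m + (x (i+1) m - x i m) * s) t))
        (C := τ * (D i * Kx + c * ω)) ?_
      · simpa using this
      · intro s hs
        rw [Set.uIoc_of_le zero_le_one] at hs
        set U0 := θ * v (r i m) + (1 - θ) * v (r i (m+1)) with hU0
        set U1 := θ * v (r (i+1) m) + (1 - θ) * v (r (i+1) (m+1)) with hU1
        have s0 : x i (m+1) = x i m + τ * U0 := H.step m hm i hi.le
        have s1 : x (i+1) (m+1) = x (i+1) m + τ * U1 := H.step m hm (i+1) hi
        have ey : x i (m+1) + (x (i+1) (m+1) - x i (m+1)) * s =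
            (x i m + (x (i+1) m - x i m) * s) + τ * ((1 - s) * U0 + s * U1) := by
          rw [s0, s1]; ring
        have hθ1' : 0 ≤ 1 - θ := by linarith
        have bU : ∀ j ≤ N, |θ * v (r j m) + (1 - θ) * v (r j (m+1))| ≤ c := by
          intro j hj
          have b1 := hc _ (rmem m hm.le j hj)
          have b2 := hc _ (rmem (m+1) hm1 j hj)
          refine (abs_add_le _ _).trans ?_
          rw [abs_mul, abs_mul, abs_of_nonneg hθ0, abs_of_nonneg hθ1']
          nlinarith
        have bU0 : |U0| ≤ c := bU i hi.le
        have bU1 : |U1| ≤ c := bU (i+1) hi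
        have hu : |(1 - s) * U0 + s * U1| ≤ c := by
          refine (abs_add_le _ _).trans ?_
          rw [abs_mul, abs_mul, abs_of_nonneg hs.1.le, abs_of_nonneg (by linarith [hs.2] : 0 ≤ 1 - s)]
          nlinarith [hs.1, hs.2]
        have hpt := cws_pt φ φt φx Kx ω c τ (m * τ) (x i m + (x (i+1) m - x i m) * s)
          ((1 - s) * U0 + s * U1) (v (r i m)) hτ hct hcx hdt hdx hKx hω hu
          (hc _ (rmem m hm.le i hi.le))
        rw [Real.norm_eq_abs, ey]
        refine hpt.trans ?_
        refine mul_le_mul_of_nonneg_left ?_ hτ.le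
        refine add_le_add (mul_le_mul_of_nonneg_right ?_ hKx0) le_rfl
        -- |u - w| ≤ D i
        have l1 := hLv _ (rmem (m+1) hm1 i hi.le) _ (rmem m hm.le i hi.le)
        have l2 := hLv _ (rmem m hm.le (i+1) hi) _ (rmem m hm.le i hi.le)
        have l3 := hLv _ (rmem (m+1) hm1 (i+1) hi) _ (rmem (m+1) hm1 i hi.le)
        have e5 : (1 - s) * U0 + s * U1 - v (r i m) =
          (1 - θ) * (v (r i (m+1)) - v (r i m)) + (s * θ * (v (r (i+1) m) - v (r i m)) +
            s * (1 - θ) * (v (r (i+1) (m+1)) - v (r i (m+1)))) := by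
          rw [hU0, hU1]; ring
        rw [e5]
        refine (abs_add_le _ _).trans (add_le_add ?_ ((abs_add_le _ _).trans ?_))
        · rw [abs_mul, abs_of_nonneg hθ1']
          refine le_trans ?_ l1
          exact mul_le_of_le_one_left (abs_nonneg _) (by linarith)
        · rw [mul_add, abs_mul (s * θ), abs_mul (s * (1 - θ)), abs_of_nonneg (mul_nonneg hs.1.le hθ0),
            abs_of_nonneg (mul_nonneg hs.1.le hθ1')]
          refine add_le_add (le_trans ?_ l2) (le_trans ?_ l3)
          · exact mul_le_of_le_one_left (abs_nonneg _) (mul_le_one₀ hs.2 hθ0 hθ1)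
          · exact mul_le_of_le_one_left (abs_nonneg _) (mul_le_one₀ hs.2 hθ1' (by linarith))
    have htv : ∀ k ≤ M, ∑ i ∈ Finset.range N, |r (i+1) k - r i k| ≤ C := by
      intro k hk
      have h1 := H.tv k hk
      have h2 : 0 ≤ Rd N l x 0 k := (rmem k hk 0 (Nat.zero_le _)).1
      simp only [r]; linarith
    have htime : ∀ i ∈ Finset.range N, l * |r i (m+1) - r i m| ≤
        R^2 * τ * Lv * (|r (i+1) m - r i m| + |r (i+1) (m+1) - r i (m+1)|) := by
      intro i hi
      have hi := Finset.mem_range.1 hi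
      refine cws_time_var l τ θ Lv R (r i m) (r (i+1) m) (r i (m+1)) (r (i+1) (m+1)) v hl hτ.le hθ0
        hθ1 hLv0 hLv (H.rb m hm.le i hi) (H.rb (m+1) hm1 i hi) (rmem m hm.le (i+1) hi)
        (rmem (m+1) hm1 (i+1) hi) ?_
      have q0 := H.rl m hm.le i hi
      have q1 := H.rl (m+1) hm1 i hi
      have p0 := (H.rb m hm.le i hi).1
      have p1 := (H.rb (m+1) hm1 i hi).1
      have d0 : l / r i m = x (i+1) m - x i m := by
        rw [div_eq_iff p0.ne', mul_comm]; exact q0.symm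
      have d1 : l / r i (m+1) = x (i+1) (m+1) - x i (m+1) := by
        rw [div_eq_iff p1.ne', mul_comm]; exact q1.symm
      rw [d0, d1, H.step m hm i hi.le, H.step m hm (i+1) hi]
      simp only [r]; ring
    have ePP : P (m+1) - P m - ∫ t in ((m:ℝ) * τ)..(((m + 1 : ℕ):ℝ) * τ), g m t =
        ∑ i ∈ Finset.range N, 
        ((l * ∫ s in (0:ℝ)..1, φ (x i (m+1) + (x (i+1) (m+1) - x i (m+1)) * s) (m * τ + τ)) -
          (l * ∫ s in (0:ℝ)..1, φ (x i m + (x (i+1) m - x i m) * s) (m * τ)) -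
          ∫ t in ((m:ℝ) * τ)..(m * τ + τ), l * ∫ s in (0:ℝ)..1,
          (φt (x i m + (x (i+1) m - x i m) * s) t +
            v (r i m) * φx (x i m + (x (i+1) m - x i m) * s) t)) := by
      rw [Finset.sum_sub_distrib, Finset.sum_sub_distrib, ← intervalIntegral.integral_finsetSum]
      · simp only [P, g, et]
      · intro i _
        exact (continuous_const.mul (hgi i m)).intervalIntegrable _ _
    rw [ePP]
    refine (Finset.abs_sum_le_sum_abs _ _).trans ((Finset.sum_le_sum hi_est).trans ?_)
    have b1 : ∑ i ∈ Finset.range N, l * |r i (m+1) - r i m| ≤ R^2 * τ * Lv *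
        (∑ i ∈ Finset.range N, |r (i+1) m - r i m| +
          ∑ i ∈ Finset.range N, |r (i+1) (m+1) - r i (m+1)|) := by
      rw [← Finset.sum_add_distrib, Finset.mul_sum]; exact Finset.sum_le_sum htime
    have b2 := htv m hm.le
    have b3 := htv (m+1) hm1
    set S0 := ∑ i ∈ Finset.range N, |r (i+1) m - r i m|
    set S1 := ∑ i ∈ Finset.range N, |r (i+1) (m+1) - r i (m+1)|
    set S2 := ∑ i ∈ Finset.range N, l * |r i (m+1) - r i m| with hS2
    have e6 : ∑ i ∈ Finset.range N, l * (τ * (D i * Kx + c * ω)) =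
        τ * (Kx * (Lv * S2 + Lv * l * (S0 + S1)) + L * c * ω) := by
      have : ∀ i ∈ Finset.range N, l * (τ * (D i * Kx + c * ω)) =
        (τ * Kx * Lv) * (l * |r i (m+1) - r i m|) + ((τ * Kx * Lv * l) * |r (i+1) m - r i m| +
         (τ * Kx * Lv * l) * |r (i+1) (m+1) - r i (m+1)|) + l * τ * c * ω := by
        intro i _; simp only [D]; ring
      rw [Finset.sum_congr rfl this, Finset.sum_add_distrib, Finset.sum_add_distrib,
        Finset.sum_add_distrib,
        ← Finset.mul_sum (Finset.range N) (fun i => l * |r i (m+1) - r i m|) (τ * Kx * Lv),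
        ← Finset.mul_sum (Finset.range N) (fun i => |r (i+1) m - r i m|) (τ * Kx * Lv * l),
        ← Finset.mul_sum (Finset.range N) (fun i => |r (i+1) (m+1) - r i (m+1)|) (τ * Kx * Lv * l)]
      change τ * Kx * Lv * S2 + (τ * Kx * Lv * l * S0 + τ * Kx * Lv * l * S1) + _ = _
      simp only [Finset.sum_const, Finset.card_range, nsmul_eq_mul]
      rw [← hNL]; ring
    rw [e6]
    have b4 : S0 + S1 ≤ 2 * C := by linarith
    have b5 : S2 ≤ R^2 * τ * Lv * (2 * C) := b1.trans (by gcongr)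
    gcongr
  have htel : ∑ m ∈ Finset.range M, (P (m+1) - P m) = P M - P 0 := Finset.sum_range_sub P M
  have hPM : P M = 0 := by simp only [P, hMT, hφT]; simp
  have hP0 : P 0 = ∑ i ∈ Finset.range N, l * ∫ s in (0:ℝ)..1, φ (x i 0 + (x (i+1) 0 - x i 0) * s) 0 := by
    simp [P]
  rw [hsplit, ← hP0]
  have e7 : (∑ m ∈ Finset.range M, ∫ t in ((m:ℝ) * τ)..(((m + 1 : ℕ):ℝ) * τ), g m t) + P 0 =
    -∑ m ∈ Finset.range M, (P (m+1) - P m - ∫ t in ((m:ℝ) * τ)..(((m + 1 : ℕ):ℝ) * τ), g m t) := by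
    rw [Finset.sum_sub_distrib, htel, hPM]; ring
  rw [e7, abs_neg]
  refine (Finset.abs_sum_le_sum_abs _ _).trans ((Finset.sum_le_sum hstep).trans (le_of_eq ?_))
  simp only [Finset.sum_const, Finset.card_range, nsmul_eq_mul]
  rw [← hMT]; ring


lemma cws_v_anti (R : ℝ) (v : ℝ → ℝ) (hv : ContDiffOn ℝ 1 v (Set.Icc 0 R))
    (hv' : ∀ ρ' ∈ Set.Icc (0 : ℝ) R, derivWithin v (Set.Icc 0 R) ρ' < 0) :
    AntitoneOn v (Set.Icc 0 R) := by
  refine (strictAntiOn_of_deriv_neg (convex_Icc 0 R) hv.continuousOn ?_).antitoneOn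
  intro z hz
  rw [← derivWithin_of_mem_nhds (mem_interior_iff_mem_nhds.1 hz)]
  exact hv' z (interior_subset hz)

lemma cws_v_bound (R : ℝ) (v : ℝ → ℝ) (hR : 0 < R) (h : AntitoneOn v (Set.Icc 0 R)) :
    ∀ a ∈ Set.Icc (0 : ℝ) R, |v a| ≤ |v 0| + |v R| := by
  intro a ha
  have h1 := h ⟨le_rfl, hR.le⟩ ha ha.1
  have h2 := h ha ⟨hR.le, le_rfl⟩ ha.2
  rw [abs_le]
  constructor
  · linarith [neg_abs_le (v R), abs_nonneg (v 0)]
  · linarith [le_abs_self (v 0), abs_nonneg (v R)]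

lemma cws_v_cont (R : ℝ) (v : ℝ → ℝ) (hR : 0 < R) (hv : ContinuousOn v (Set.Icc 0 R))
    (hvleft : ∀ ρ' < (0 : ℝ), v ρ' = v 0)
    (hvright : ∀ ρ', R < ρ' → v ρ' = v R) : Continuous v := by
  have : v = Set.IccExtend hR.le (Set.domRestrict (Set.Icc 0 R) v) := by
    funext z
    rcases lt_or_ge z 0 with h | h
    · rw [Set.IccExtend_of_le_left _ _ h.le, hvleft z h]; rfl
    · rcases lt_or_ge R z with h' | h'
      · rw [Set.IccExtend_of_right_le _ _ h'.le, hvright z h']; rfl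
      · rw [Set.IccExtend_of_mem _ _ ⟨h, h'⟩]; rfl
  rw [this]
  exact (continuousOn_iff_continuous_domRestrict.1 hv).Icc_extend'

lemma cws_cfg (R T L θ Lv c : ℝ) (v : ℝ → ℝ) (ρb : ℝ → ℝ) (N M : ℕ) (x : ℕ → ℕ → ℝ)
    (hR : 0 < R) (hT : 0 < T) (hLpos : 0 < L) (hθ : θ ∈ Set.Icc (0 : ℝ) 1)
    (hanti : AntitoneOn v (Set.Icc 0 R))
    (hLv : ∀ a ∈ Set.Icc (0 : ℝ) R, ∀ b ∈ Set.Icc (0 : ℝ) R, |v a - v b| ≤ Lv * |a - b|)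
    (hc0 : 0 ≤ c) (hc : ∀ a ∈ Set.Icc (0 : ℝ) R, |v a| ≤ c)
    (hBV : BoundedVariationOn ρb Set.univ)
    (hsupp : HasCompactSupport ρb)
    (hbound : ∀ᵐ z ∂(volume : Measure ℝ), ρb z ∈ Set.Icc 0 R)
    (hLdef : (∫ z, ρb z) = L) (hIntg : Integrable ρb)
    (hN : 0 < N) (hM : 0 < M)
    (hCFL : θ * N * T * Lv * R ^ 2 < L * M)
    (hscheme : IsScheme N M (L / N) (T / M) θ v x)
    (hinit0 : x 0 0 = sInf (tsupport ρb))
    (hinit : ∀ i < N,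
      IsLeast {z : ℝ | x i 0 ≤ z ∧ L / N ≤ ∫ s in (x i 0)..z, ρb s} (x (i + 1) 0))
    (hbnd : ∀ m ≤ M, ∀ i < N, 0 < Rd N (L / N) x i m ∧ Rd N (L / N) x i m ≤ R) :
    CwsCfg R Lv (R + ((eVariationOn ρb Set.univ).toReal + R)) (sInf (tsupport ρb) - c * T)
      (sSup (tsupport ρb) + c * T) θ v N M (L / N) (T / M) x ∧
      ∀ m < M, ∀ i ≤ N, |x i (m+1) - x i m| ≤ c * (T / M) := by
  have hN' : (0:ℝ) < N := by exact_mod_cast hN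
  have hM' : (0:ℝ) < M := by exact_mod_cast hM
  have hl : 0 < L / N := by positivity
  have hτ : 0 < T / M := by positivity
  set l := L / (N:ℝ) with hldef
  set τ := T / (M:ℝ) with hτdef
  obtain ⟨hq1, hq2, -⟩ := cws_quantile L R ρb N (fun i => x i 0) hLpos hN hIntg hsupp hbound hLdef
    hinit0 hinit
  have hrN : ∀ m, Rd N l x N m = 0 := fun m => by simp [Rd]
  have hrl : ∀ m ≤ M, ∀ i < N, Rd N l x i m * (x (i+1) m - x i m) = l := by
    intro m hm i hi
    have := hscheme.1 m hm i hi
    have h2 : x (i+1) m - x i m ≠ 0 := by linarith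
    simp only [Rd, hi, if_true]
    field_simp
  have hstep : ∀ m < M, ∀ i ≤ N, x i (m+1) = x i m +
      τ * (θ * v (Rd N l x i m) + (1 - θ) * v (Rd N l x i (m+1))) := by
    intro m hm i hi
    rcases Nat.lt_or_ge i N with h | h
    · exact hscheme.2.2 m hm i h
    · have : i = N := le_antisymm hi h
      rw [this, hrN, hrN, hscheme.2.1 m hm]; ring
  have rmem : ∀ m ≤ M, ∀ i ≤ N, Rd N l x i m ∈ Set.Icc 0 R := by
    intro m hm i hi
    rcases Nat.lt_or_ge i N with h | h
    · exact ⟨(hbnd m hm i h).1.le, (hbnd m hm i h).2⟩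
    · have : i = N := le_antisymm hi h
      rw [this, hrN]; exact ⟨le_rfl, hR.le⟩
  have hmove : ∀ m < M, ∀ i ≤ N, |x i (m+1) - x i m| ≤ c * τ := by
    intro m hm i hi
    rw [hstep m hm i hi, add_sub_cancel_left, abs_mul, abs_of_pos hτ, mul_comm]
    refine mul_le_mul_of_nonneg_right ?_ hτ.le
    have b1 := hc _ (rmem m hm.le i hi)
    have b2 := hc _ (rmem (m+1) hm i hi)
    refine (abs_add_le _ _).trans ?_
    have hθ1' : 0 ≤ 1 - θ := by linarith [hθ.2]
    rw [abs_mul, abs_mul, abs_of_nonneg hθ.1, abs_of_nonneg hθ1']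
    nlinarith [hθ.1]
  have hdist : ∀ m ≤ M, ∀ i ≤ N, |x i m - x i 0| ≤ c * (m * τ) := by
    intro m
    induction m with
    | zero => intro _ i _; simp
    | succ m ih =>
      intro hm i hi
      have h1 := ih (by omega) i hi
      have h2 := hmove m hm i hi
      have : x i (m+1) - x i 0 = (x i (m+1) - x i m) + (x i m - x i 0) := by ring
      rw [this]
      refine (abs_add_le _ _).trans ?_
      push_cast; linarith
  have hmT : ∀ m ≤ M, c * (m * τ) ≤ c * T := by
    intro m hm
    refine mul_le_mul_of_nonneg_left ?_ hc0
    have : (m:ℝ) ≤ M := by exact_mod_cast hm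
    calc (m:ℝ) * τ ≤ M * τ := by gcongr
      _ = T := by rw [hτdef]; field_simp
  have hcfl : τ * θ * Lv * R^2 ≤ l := by
    rw [hτdef, hldef, le_div_iff₀ hN']
    have : T / M * θ * Lv * R ^ 2 * N = (θ * N * T * Lv * R ^ 2) / M := by ring
    rw [this, div_le_iff₀ hM']; exact hCFL.le
  have htv : ∀ m ≤ M, ∑ i ∈ Finset.range N, |Rd N l x (i+1) m - Rd N l x i m| ≤
      (eVariationOn ρb Set.univ).toReal + R := by
    intro m
    induction m with
    | zero =>
      intro hm
      exact cws_init_tv l R ρb N (fun i => x i 0) (fun i => Rd N l x i 0) hIntg hBV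
        (hscheme.1 0 hm) hq1 (hrl 0 hm) (hbnd 0 hm) hR.le (hrN 0)
    | succ m ih =>
      intro hm
      refine le_trans ?_ (ih (by omega))
      refine cws_tv_step N l τ θ Lv R v (fun i => Rd N l x i m) (fun i => Rd N l x i (m+1)) hl hτ.le
        hθ.1 hθ.2 hcfl hanti hLv hR (hbnd m (by omega)) (hbnd (m+1) hm) (hrN m) (hrN (m+1)) ?_
      intro i hi
      have q0 := hrl m (by omega) i hi
      have q1 := hrl (m+1) hm i hi
      have p0 := (hbnd m (by omega) i hi).1
      have p1 := (hbnd (m+1) hm i hi).1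
      have d0 : l / Rd N l x i m = x (i+1) m - x i m := by
        rw [div_eq_iff p0.ne', mul_comm]; exact q0.symm
      have d1 : l / Rd N l x i (m+1) = x (i+1) (m+1) - x i (m+1) := by
        rw [div_eq_iff p1.ne', mul_comm]; exact q1.symm
      rw [d0, d1, hstep m hm i hi.le, hstep m hm (i+1) hi]
      ring
  refine ⟨⟨hl, hτ, hscheme.1, hbnd, hrN, hrl, hstep, ?_, ?_, ?_⟩, hmove⟩
  · intro m hm
    exact add_le_add (rmem m hm 0 (Nat.zero_le _)).2 (htv m hm)
  · intro m hm
    have h1 := (abs_le.1 (hdist m hm 0 (Nat.zero_le _))).1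
    have h2 := hmT m hm
    rw [← hinit0]; linarith
  · intro m hm
    have h1 := (abs_le.1 (hdist m hm N le_rfl)).2
    have h2 := hmT m hm
    have h3 := hq2 N le_rfl
    linarith

/-- Time oscillation of the cumulative functions. -/
lemma cws_cum_osc (R Lv C A B θ c : ℝ) (v : ℝ → ℝ) (N M : ℕ) (l τ : ℝ) (x : ℕ → ℕ → ℝ)
    (H : CwsCfg R Lv C A B θ v N M l τ x) (hR : 0 < R) (hc0 : 0 ≤ c)
    (hmove : ∀ m < M, ∀ i ≤ N, |x i (m+1) - x i m| ≤ c * τ) (y : ℝ) (m k : ℕ) (hm : m ≤ M)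
    (hk : k ≤ M) :
    |cwsCum N (fun i => Rd N l x i m) (fun i => x i m) y -
      cwsCum N (fun i => Rd N l x i k) (fun i => x i k) y| ≤ R * (c * τ) * |(m:ℝ) - k| := by
  have key : ∀ j m, m + j ≤ M → |cwsCum N (fun i => Rd N l x i (m+j)) (fun i => x i (m+j)) y -
      cwsCum N (fun i => Rd N l x i m) (fun i => x i m) y| ≤ R * (c * τ) * j := by
    intro j
    induction j with
    | zero => intro m _; simp
    | succ j ih =>
      intro m hmj
      have h1 := ih m (by omega)
      have h2 := cws_cum_time N (fun i => Rd N l x i (m+j)) (fun i => x i (m+j))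
        (fun i => Rd N l x i (m+j+1)) (fun i => x i (m+j+1)) R l (c * τ) hR.le H.hl
        (mul_nonneg hc0 H.hτ.le) (H.mono _ (by omega)) (H.mono _ (by omega))
        (fun i hi => ⟨(H.rb _ (by omega) i hi).1.le, (H.rb _ (by omega) i hi).2⟩)
        (fun i hi => ⟨(H.rb _ (by omega) i hi).1.le, (H.rb _ (by omega) i hi).2⟩)
        (H.rl _ (by omega)) (H.rl _ (by omega)) (hmove (m+j) (by omega)) y
      rw [← add_assoc]
      refine (abs_sub_le _ _ _).trans ((add_le_add h2 h1).trans (le_of_eq ?_))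
      push_cast; ring
  rcases le_total m k with h | h
  · obtain ⟨j, rfl⟩ := Nat.exists_eq_add_of_le h
    rw [abs_sub_comm]
    refine (key j m hk).trans (le_of_eq ?_)
    push_cast
    rw [sub_add_cancel_left, abs_neg, abs_of_nonneg (Nat.cast_nonneg j)]
  · obtain ⟨j, rfl⟩ := Nat.exists_eq_add_of_le h
    refine (key j k hm).trans (le_of_eq ?_)
    push_cast
    rw [add_sub_cancel_left, abs_of_nonneg (Nat.cast_nonneg j)]


lemma cws_floor (a b : ℝ) (ha : 0 ≤ a) (hb : 0 ≤ b) :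
    |((⌊a⌋₊ : ℕ) : ℝ) - (⌊b⌋₊ : ℕ)| ≤ |a - b| + 1 := by
  have h1 := Nat.floor_le ha
  have h2 := Nat.floor_le hb
  have h3 := Nat.lt_floor_add_one a
  have h4 := Nat.lt_floor_add_one b
  have h5 := abs_le.1 (le_refl |a - b|)
  rw [abs_le]
  constructor <;> linarith [h5.1, h5.2]

lemma cws_compact (R Lv C A B θ c T L : ℝ) (v : ℝ → ℝ) (Nn Mn : ℕ → ℕ) (l τ : ℕ → ℝ)
    (x : ℕ → ℕ → ℕ → ℝ)
    (H : ∀ n, CwsCfg R Lv C A B θ v (Nn n) (Mn n) (l n) (τ n) (x n)) (hR : 0 < R) (hc0 : 0 ≤ c)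
    (hT : 0 < T) (hC : 0 ≤ C) (hAB : A ≤ B)
    (hmove : ∀ n, ∀ m < Mn n, ∀ i ≤ Nn n, |x n i (m+1) - x n i m| ≤ c * τ n)
    (hMT : ∀ n, Mn n * τ n = T) (hNL : ∀ n, Nn n * l n = L)
    (hτ0 : Tendsto τ atTop (nhds 0)) :
    ∃ φs : ℕ → ℕ, StrictMono φs ∧ ∀ δ > 0, ∃ k0, ∀ k ≥ k0, ∀ j ≥ k0, ∀ t ∈ Set.Ico (0:ℝ) T,
      ∫ y, |discDens (Nn (φs k)) (Mn (φs k)) (l (φs k)) (τ (φs k)) (x (φs k)) y t -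
        discDens (Nn (φs j)) (Mn (φs j)) (l (φs j)) (τ (φs j)) (x (φs j)) y t| ≤ δ := by
  let F : ℕ → (Set.Icc A (B+1)) × (Set.Icc (0:ℝ) T) → ℝ := fun n p =>
    cwsCum (Nn n) (fun i => Rd (Nn n) (l n) (x n) i ⌊p.2.1 / τ n⌋₊)
      (fun i => x n i ⌊p.2.1 / τ n⌋₊) p.1.1
  have hfl : ∀ n, ∀ t ∈ Set.Icc (0:ℝ) T, ⌊t / τ n⌋₊ ≤ Mn n := by
    intro n t ht
    apply Nat.floor_le_of_le
    rw [div_le_iff₀ (H n).hτ, hMT]; exact ht.2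
  have : Nonempty ((Set.Icc A (B+1)) × (Set.Icc (0:ℝ) T)) :=
    ⟨(⟨A, le_rfl, by linarith⟩, ⟨0, le_rfl, hT.le⟩)⟩
  obtain ⟨φs, hφs, hcau⟩ := cws_ascoli F L (R + R * c) (fun n => R * c * τ n) (by positivity)
    (by
      intro n p
      have hm := hfl n p.2.1 p.2.2
      have := cws_cum_bound (Nn n) (fun i => Rd (Nn n) (l n) (x n) i ⌊p.2.1 / τ n⌋₊)
        (fun i => x n i ⌊p.2.1 / τ n⌋₊) (l n) ((H n).mono _ hm)
        (fun i hi => ((H n).rb _ hm i hi).1.le) ((H n).rl _ hm) p.1.1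
      rwa [hNL] at this)
    (by
      intro n p q
      have hm := hfl n p.2.1 p.2.2
      have hm' := hfl n q.2.1 q.2.2
      have hτ := (H n).hτ
      have h1 := cws_cum_lip (Nn n) (fun i => Rd (Nn n) (l n) (x n) i ⌊p.2.1 / τ n⌋₊)
        (fun i => x n i ⌊p.2.1 / τ n⌋₊) R hR.le ((H n).mono _ hm)
        (fun i hi => ⟨((H n).rb _ hm i hi).1.le, ((H n).rb _ hm i hi).2⟩) p.1.1 q.1.1
      have h2 := cws_cum_osc R Lv C A B θ c v _ _ _ _ _ (H n) hR hc0 (hmove n) q.1.1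
        ⌊p.2.1 / τ n⌋₊ ⌊q.2.1 / τ n⌋₊ hm hm'
      have h3 := cws_floor (p.2.1 / τ n) (q.2.1 / τ n) (div_nonneg p.2.2.1 hτ.le)
        (div_nonneg q.2.2.1 hτ.le)
      rw [← sub_div, abs_div, abs_of_pos hτ] at h3
      have d1 : |p.1.1 - q.1.1| ≤ dist p q := by
        rw [← Real.dist_eq]; exact le_max_left _ _
      have d2 : |p.2.1 - q.2.1| ≤ dist p q := by
        rw [← Real.dist_eq]; exact le_max_right _ _
      have h4 : τ n * |((⌊p.2.1 / τ n⌋₊ : ℕ):ℝ) - (⌊q.2.1 / τ n⌋₊ : ℕ)| ≤ dist p q + τ n := by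
        have := mul_le_mul_of_nonneg_left h3 hτ.le
        rw [mul_add, mul_div_cancel₀ _ hτ.ne', mul_one] at this
        linarith
      calc |F n p - F n q| ≤ R * |p.1.1 - q.1.1| + R * (c * τ n) *
            |((⌊p.2.1 / τ n⌋₊ : ℕ):ℝ) - (⌊q.2.1 / τ n⌋₊ : ℕ)| :=
            (abs_sub_le _ _ _).trans (add_le_add h1 h2)
        _ = R * |p.1.1 - q.1.1| + R * c * (τ n *
            |((⌊p.2.1 / τ n⌋₊ : ℕ):ℝ) - (⌊q.2.1 / τ n⌋₊ : ℕ)|) := by ring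
        _ ≤ R * dist p q + R * c * (dist p q + τ n) := by gcongr
        _ = _ := by ring)
    (by simpa using hτ0.const_mul (R * c))
  refine ⟨φs, hφs, fun δ hδ => ?_⟩
  have hBA : 0 ≤ B - A := by linarith
  set h := min 1 (δ / (4 * (C + 1))) with hh
  have hhpos : 0 < h := by
    rw [hh]; exact lt_min one_pos (by positivity)
  have hh1 : h ≤ 1 := min_le_left _ _
  have hh2 : 2 * h * C ≤ δ / 2 := by
    have : h ≤ δ / (4 * (C + 1)) := min_le_right _ _
    rw [le_div_iff₀ (by positivity)] at this
    nlinarith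
  obtain ⟨k0, hk0⟩ := hcau (δ * h / (4 * (B - A + 1))) (by positivity)
  refine ⟨k0, fun k hk j hj t ht => ?_⟩
  have hfl' : ∀ n, ⌊t / τ n⌋₊ < Mn n := by
    intro n
    rw [Nat.floor_lt (div_nonneg ht.1 (H n).hτ.le), div_lt_iff₀ (H n).hτ, hMT]; exact ht.2
  have hmem : ∀ n, t ∈ Set.Ico (((⌊t / τ n⌋₊ : ℕ):ℝ) * τ n) ((((⌊t / τ n⌋₊ : ℕ):ℝ) + 1) * τ n) := by
    intro n
    have hτ := (H n).hτ
    constructor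
    · rw [← le_div_iff₀ hτ]; exact Nat.floor_le (div_nonneg ht.1 hτ.le)
    · rw [← div_lt_iff₀ hτ]; exact Nat.lt_floor_add_one _
  have e : ∀ n y, discDens (Nn n) (Mn n) (l n) (τ n) (x n) y t =
      cwsDens (Nn n) (fun i => Rd (Nn n) (l n) (x n) i ⌊t / τ n⌋₊)
      (fun i => x n i ⌊t / τ n⌋₊) y := fun n y =>
    cws_disc_eq _ _ _ _ _ (H n).hτ _ (hfl' n) y t (hmem n)
  simp only [e]
  have r0 : ∀ n, 0 ≤ Rd (Nn n) (l n) (x n) 0 ⌊t / τ n⌋₊ := by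
    intro n
    rcases Nat.eq_zero_or_pos (Nn n) with h | h
    · have := (H n).rN ⌊t / τ n⌋₊
      rw [h] at this ⊢; exact this.ge
    · exact ((H n).rb _ (hfl' n).le 0 h).1.le
  refine (cws_L1 (Nn (φs k)) (Nn (φs j))
    (fun i => Rd (Nn (φs k)) (l (φs k)) (x (φs k)) i ⌊t / τ (φs k)⌋₊)
    (fun i => x (φs k) i ⌊t / τ (φs k)⌋₊)
    (fun i => Rd (Nn (φs j)) (l (φs j)) (x (φs j)) i ⌊t / τ (φs j)⌋₊)
    (fun i => x (φs j) i ⌊t / τ (φs j)⌋₊) A B C h (δ * h / (4 * (B - A + 1))) ((H _).mono _ (hfl' _).le) (r0 _)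
    ((H _).rN _) ((H _).mono _ (hfl' _).le) (r0 _) ((H _).rN _) ((H _).tv _ (hfl' _).le)
    ((H _).tv _ (hfl' _).le) ((H _).lo _ (hfl' _).le) ((H _).lo _ (hfl' _).le)
    ((H _).hi _ (hfl' _).le) ((H _).hi _ (hfl' _).le) hAB hhpos hh1 ?_).trans ?_
  · intro y hy
    exact hk0 k hk j hj (⟨y, hy⟩, ⟨t, ht.1, ht.2.le⟩)
  · have e2 : 2 * (δ * h / (4 * (B - A + 1))) / h * (B - A) = (δ / 2) * ((B - A) / (B - A + 1)) := by
      field_simp; ring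
    rw [e2]
    have : (B - A) / (B - A + 1) ≤ 1 := by rw [div_le_one (by linarith)]; linarith
    nlinarith


/-- The finite measure on the space-time box. -/
noncomputable def cwsMu (A B T : ℝ) : Measure (ℝ × ℝ) :=
  ((volume : Measure ℝ).restrict (Set.Icc A B)).prod ((volume : Measure ℝ).restrict (Set.Ioo 0 T))

instance cwsMu_finite (A B T : ℝ) : IsFiniteMeasure (cwsMu A B T) := by
  unfold cwsMu; infer_instance

lemma cws_ae_mu (A B T : ℝ) : ∀ᵐ p ∂(cwsMu A B T), p.1 ∈ Set.Icc A B ∧ p.2 ∈ Set.Ioo 0 T := by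
  unfold cwsMu
  rw [Measure.prod_restrict]
  filter_upwards [ae_restrict_mem (measurableSet_Icc.prod measurableSet_Ioo)] with p hp
  exact hp

lemma cws_int_mu (A B T K : ℝ) (G : ℝ → ℝ → ℝ) (hm : Measurable (Function.uncurry G))
    (hb : ∀ t ∈ Set.Ioo 0 T, ∀ y, |G y t| ≤ K) : Integrable (Function.uncurry G) (cwsMu A B T) := by
  refine Integrable.of_bound hm.aestronglyMeasurable K ?_
  filter_upwards [cws_ae_mu A B T] with p hp
  exact hb p.2 hp.2 p.1

lemma cws_bridge (A B T K : ℝ) (hT : 0 < T) (G : ℝ → ℝ → ℝ) (hm : Measurable (Function.uncurry G))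
    (hb : ∀ t ∈ Set.Ioo 0 T, ∀ y, |G y t| ≤ K)
    (hz : ∀ t ∈ Set.Ioo 0 T, ∀ y, y ∉ Set.Icc A B → G y t = 0) :
    ∫ t in (0:ℝ)..T, ∫ y, G y t = ∫ p, Function.uncurry G p ∂(cwsMu A B T) := by
  have hi := cws_int_mu A B T K G hm hb
  unfold cwsMu at hi ⊢
  rw [integral_prod_symm _ hi, intervalIntegral.integral_of_le hT.le, integral_Ioc_eq_integral_Ioo]
  refine setIntegral_congr_fun measurableSet_Ioo fun t ht => ?_
  simp only [Function.uncurry]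
  rw [setIntegral_eq_integral_of_forall_compl_eq_zero]
  exact fun y hy => hz t ht y hy

lemma cws_limit (R T A B : ℝ) (hR : 0 < R) (hT : 0 < T) (f : ℕ → ℝ → ℝ → ℝ)
    (hm : ∀ n, Measurable (Function.uncurry (f n)))
    (hb : ∀ n, ∀ t ∈ Set.Ico 0 T, ∀ y, f n y t ∈ Set.Icc 0 R)
    (hz : ∀ n, ∀ t ∈ Set.Ico 0 T, ∀ y, y ∉ Set.Icc A B → f n y t = 0)
    (hcau : ∀ δ > 0, ∃ k0, ∀ k ≥ k0, ∀ j ≥ k0, ∀ t ∈ Set.Ico 0 T, ∫ y, |f k y t - f j y t| ≤ δ) :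
    ∃ ρ : ℝ → ℝ → ℝ, Measurable (Function.uncurry ρ) ∧ (∀ y t, ρ y t ∈ Set.Icc 0 R) ∧
      (∀ y t, y ∉ Set.Icc A B → ρ y t = 0) ∧
      Tendsto (fun k => ∫ t in (0:ℝ)..T, ∫ y, |f k y t - ρ y t|) atTop (nhds 0) := by
  have hIo : ∀ t, t ∈ Set.Ioo 0 T → t ∈ Set.Ico 0 T := fun t ht => ⟨ht.1.le, ht.2⟩
  have hfb : ∀ n, ∀ t ∈ Set.Ioo 0 T, ∀ y, |f n y t| ≤ R := by
    intro n t ht y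
    have := hb n t (hIo t ht) y
    rw [abs_of_nonneg this.1]; exact this.2
  have hi : ∀ n, Integrable (Function.uncurry (f n)) (cwsMu A B T) := fun n =>
    cws_int_mu A B T R _ (hm n) (hfb n)
  let u : ℕ → (ℝ × ℝ →₁[cwsMu A B T] ℝ) := fun n => (hi n).toL1 _
  have hsub : ∀ k j, ∫ t in (0:ℝ)..T, ∫ y, |f k y t - f j y t| =
      ∫ p, |Function.uncurry (f k) p - Function.uncurry (f j) p| ∂(cwsMu A B T) := by
    intro k j
    refine cws_bridge A B T R hT (fun y t => |f k y t - f j y t|) ?_ ?_ ?_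
    · exact ((hm k).sub (hm j)).abs
    · intro t ht y
      rw [abs_abs, abs_le]
      have h1 := hb k t (hIo t ht) y
      have h2 := hb j t (hIo t ht) y
      constructor <;> linarith [h1.1, h1.2, h2.1, h2.2]
    · intro t ht y hy
      rw [hz k t (hIo t ht) y hy, hz j t (hIo t ht) y hy]; simp
  have hcs : CauchySeq u := by
    rw [Metric.cauchySeq_iff]
    intro ε hε
    obtain ⟨k0, hk0⟩ := hcau (ε / (2 * T)) (by positivity)
    refine ⟨k0, fun k hk j hj => ?_⟩
    rw [dist_eq_norm]
    have e1 : u k - u j = ((hi k).sub (hi j)).toL1 _ := (Integrable.toL1_sub _ _ _ _).symm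
    rw [e1, L1.norm_of_fun_eq_integral_norm]
    have e2 : ∫ p, ‖(Function.uncurry (f k) - Function.uncurry (f j)) p‖ ∂(cwsMu A B T) =
      ∫ t in (0:ℝ)..T, ∫ y, |f k y t - f j y t| := (hsub k j).symm
    rw [e2]
    have := intervalIntegral.norm_integral_le_of_norm_le_const_ae (a := 0) (b := T)
      (f := fun t => ∫ y, |f k y t - f j y t|) (C := ε / (2 * T)) ?_
    · rw [sub_zero, abs_of_pos hT] at this
      refine lt_of_le_of_lt ((le_abs_self _).trans this) ?_
      have : ε / (2 * T) * T = ε / 2 := by field_simp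
      linarith
    · have hne : ∀ᵐ t ∂(volume : Measure ℝ), t ≠ T := by
        simp [ae_iff]
      filter_upwards [hne] with t htT ht
      rw [Set.uIoc_of_le hT.le] at ht
      rw [Real.norm_eq_abs, abs_of_nonneg (integral_nonneg fun _ => abs_nonneg _)]
      exact hk0 k hk j hj t ⟨ht.1.le, lt_of_le_of_ne ht.2 htT⟩
  obtain ⟨g, hg⟩ := cauchySeq_tendsto_of_complete hcs
  have hgm : Measurable (g : ℝ × ℝ → ℝ) := (Lp.stronglyMeasurable g).measurable
  let ρ : ℝ → ℝ → ℝ := fun y t => Set.indicator (Set.Icc A B) (fun y => max 0 (min (g (y, t)) R)) y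
  have hρm : Measurable (Function.uncurry ρ) := by
    have : Function.uncurry ρ = Set.indicator (Prod.fst ⁻¹' (Set.Icc A B))
        (fun p : ℝ × ℝ => max 0 (min (g p) R)) := by
      funext p
      rcases p with ⟨y, t⟩
      simp only [Function.uncurry, ρ, Set.indicator, Set.mem_preimage]
    rw [this]
    refine Measurable.indicator ?_ (measurable_fst measurableSet_Icc)
    exact measurable_const.max (hgm.min measurable_const)
  have hρb : ∀ y t, ρ y t ∈ Set.Icc 0 R := by
    intro y t
    simp only [ρ, Set.indicator]
    split_ifs
    · exact ⟨le_max_left _ _, max_le hR.le (min_le_right _ _)⟩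
    · exact ⟨le_rfl, hR.le⟩
  have hρz : ∀ y t, y ∉ Set.Icc A B → ρ y t = 0 := by
    intro y t hy
    exact Set.indicator_of_notMem hy _
  refine ⟨ρ, hρm, hρb, hρz, ?_⟩
  have hlim : Tendsto (fun k => ‖u k - g‖) atTop (nhds 0) := by
    have := (tendsto_iff_norm_sub_tendsto_zero).1 hg
    exact this
  refine squeeze_zero (fun k => ?_) (fun k => ?_) hlim
  · exact intervalIntegral.integral_nonneg hT.le fun t _ => integral_nonneg fun _ => abs_nonneg _
  · have hbd : ∀ t ∈ Set.Ioo 0 T, ∀ y, |(|f k y t - ρ y t|)| ≤ R := by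
      intro t ht y
      rw [abs_abs, abs_le]
      have h1 := hb k t (hIo t ht) y
      have h2 := hρb y t
      constructor <;> linarith [h1.1, h1.2, h2.1, h2.2]
    have hmm : Measurable (Function.uncurry fun y t => |f k y t - ρ y t|) :=
      ((hm k).sub hρm).abs
    rw [cws_bridge A B T R hT (fun y t => |f k y t - ρ y t|) hmm hbd (by
      intro t ht y hy
      rw [hz k t (hIo t ht) y hy, hρz y t hy]; simp)]
    rw [L1.norm_eq_integral_norm]
    refine integral_mono_ae (cws_int_mu A B T R _ hmm hbd) (L1.integrable_coeFn _).norm ?_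
    filter_upwards [cws_ae_mu A B T, Lp.coeFn_sub (u k) g, (hi k).coeFn_toL1] with p hp h1 h2
    rcases p with ⟨y, t⟩
    rw [h1]
    simp only [Pi.sub_apply, Function.uncurry]
    rw [h2]
    simp only [Function.uncurry, Real.norm_eq_abs, ρ]
    rw [Set.indicator_of_mem hp.1]
    have h3 := hb k t (hIo t hp.2) y
    generalize (g (y, t)) = a
    generalize f k y t = b at h3
    rcases le_total a R with ha | ha
    · rw [min_eq_left ha]
      rcases le_total 0 a with h0 | h0
      · rw [max_eq_right h0]
      · rw [max_eq_left h0, sub_zero, abs_of_nonneg h3.1, abs_of_nonneg (by linarith [h3.1])]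
        linarith
    · rw [min_eq_right ha, max_eq_right hR.le, abs_sub_comm, abs_of_nonneg (by linarith [h3.2]),
        abs_sub_comm, abs_of_nonneg (by linarith [h3.2])]
      linarith


lemma cws_disc_meas (N M : ℕ) (l τ : ℝ) (x : ℕ → ℕ → ℝ) :
    Measurable (Function.uncurry (discDens N M l τ x)) := by
  have : Function.uncurry (discDens N M l τ x) = fun p : ℝ × ℝ =>
    ∑ m ∈ Finset.range M, ∑ i ∈ Finset.range N,
    Rd N l x i m * Set.indicator (Set.Ico (x i m) (x (i + 1) m)) (fun _ => (1 : ℝ)) p.1 *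
      Set.indicator (Set.Ico ((m : ℝ) * τ) (((m : ℝ) + 1) * τ)) (fun _ => (1 : ℝ)) p.2 := by
    funext p; rfl
  rw [this]
  refine Finset.measurable_sum _ fun m _ => Finset.measurable_sum _ fun i _ => ?_
  refine Measurable.mul (measurable_const.mul ?_) ?_
  · exact (measurable_const.indicator measurableSet_Ico).comp measurable_fst
  · exact (measurable_const.indicator measurableSet_Ico).comp measurable_snd

lemma cws_disc_props (R Lv C A B θ T : ℝ) (v : ℝ → ℝ) (N M : ℕ) (l τ : ℝ) (x : ℕ → ℕ → ℝ)
    (H : CwsCfg R Lv C A B θ v N M l τ x) (hR : 0 < R) (hMT : M * τ = T) (t : ℝ)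
    (ht : t ∈ Set.Ico 0 T) (y : ℝ) :
    discDens N M l τ x y t ∈ Set.Icc 0 R ∧ (y ∉ Set.Icc A B → discDens N M l τ x y t = 0) := by
  have hτ := H.hτ
  have hfl' : ⌊t / τ⌋₊ < M := by
    rw [Nat.floor_lt (div_nonneg ht.1 hτ.le), div_lt_iff₀ hτ, hMT]; exact ht.2
  have hmem : t ∈ Set.Ico (((⌊t / τ⌋₊ : ℕ):ℝ) * τ) ((((⌊t / τ⌋₊ : ℕ):ℝ) + 1) * τ) := by
    constructor
    · rw [← le_div_iff₀ hτ]; exact Nat.floor_le (div_nonneg ht.1 hτ.le)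
    · rw [← div_lt_iff₀ hτ]; exact Nat.lt_floor_add_one _
  rw [cws_disc_eq N M l τ x hτ _ hfl' y t hmem]
  refine ⟨⟨cws_dens_nonneg _ _ _ (fun i hi => (H.rb _ hfl'.le i hi).1.le) y,
    cws_dens_le _ _ _ R hR.le (H.mono _ hfl'.le) (fun i hi => (H.rb _ hfl'.le i hi).2) y⟩, ?_⟩
  intro hy
  refine cws_dens_zero _ _ _ (H.mono _ hfl'.le) y ?_
  by_contra hc
  push Not at hc
  exact hy ⟨(H.lo _ hfl'.le).trans hc.1, hc.2.le.trans (H.hi _ hfl'.le)⟩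

lemma cws_test (φ : ℝ → ℝ → ℝ) (h1 : ContDiff ℝ 1 (Function.uncurry φ))
    (h2 : HasCompactSupport (Function.uncurry φ)) :
    ∃ φt φx : ℝ → ℝ → ℝ, ∃ K b : ℝ, 0 ≤ K ∧
      Continuous (Function.uncurry φt) ∧ Continuous (Function.uncurry φx) ∧
      (∀ y t, HasDerivAt (fun s => φ y s) (φt y t) t) ∧
      (∀ y t, HasDerivAt (fun z => φ z t) (φx y t) y) ∧
      (∀ y t, |φt y t| ≤ K) ∧ (∀ y t, |φx y t| ≤ K) ∧ (∀ y t, |φ y t| ≤ b) ∧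
      (∀ y z, |φ y 0 - φ z 0| ≤ K * |y - z|) ∧
      (∀ ε > 0, ∃ δ > 0, ∀ y z t s, |y - z| < δ → |t - s| < δ → |φx y t - φx z s| ≤ ε) := by
  have hdf : ∀ p, HasFDerivAt (Function.uncurry φ) (fderiv ℝ (Function.uncurry φ) p) p := fun p =>
    (h1.differentiable one_ne_zero p).hasFDerivAt
  have hcf : Continuous (fderiv ℝ (Function.uncurry φ)) := h1.continuous_fderiv one_ne_zero
  have hsf : HasCompactSupport (fderiv ℝ (Function.uncurry φ)) := h2.fderiv ℝ
  let φt : ℝ → ℝ → ℝ := fun y t => fderiv ℝ (Function.uncurry φ) (y, t) (0, 1)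
  let φx : ℝ → ℝ → ℝ := fun y t => fderiv ℝ (Function.uncurry φ) (y, t) (1, 0)
  have hct : Continuous (Function.uncurry φt) := hcf.clm_apply continuous_const
  have hcx : Continuous (Function.uncurry φx) := hcf.clm_apply continuous_const
  have hst : HasCompactSupport (Function.uncurry φt) :=
    hsf.comp_left (g := fun A : ℝ × ℝ →L[ℝ] ℝ => A (0, 1)) rfl
  have hsx : HasCompactSupport (Function.uncurry φx) :=
    hsf.comp_left (g := fun A : ℝ × ℝ →L[ℝ] ℝ => A (1, 0)) rfl
  obtain ⟨Kt, hKt⟩ := hst.exists_bound_of_continuous hct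
  obtain ⟨Kx, hKx⟩ := hsx.exists_bound_of_continuous hcx
  obtain ⟨b, hb⟩ := h2.exists_bound_of_continuous h1.continuous
  have hdt : ∀ y t, HasDerivAt (fun s => φ y s) (φt y t) t := by
    intro y t
    have hg : HasDerivAt (fun s : ℝ => (y, s)) ((0 : ℝ), (1 : ℝ)) t :=
      (hasDerivAt_const t y).prodMk (hasDerivAt_id t)
    exact (hdf (y, t)).comp_hasDerivAt t hg
  have hdx : ∀ y t, HasDerivAt (fun z => φ z t) (φx y t) y := by
    intro y t
    have hg : HasDerivAt (fun s : ℝ => (s, t)) ((1 : ℝ), (0 : ℝ)) y :=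
      (hasDerivAt_id y).prodMk (hasDerivAt_const y t)
    exact (hdf (y, t)).comp_hasDerivAt y hg
  have kx : ∀ y t, |φx y t| ≤ max Kt Kx := fun y t => (hKx (y, t)).trans (le_max_right _ _)
  refine ⟨φt, φx, max Kt Kx, b, (abs_nonneg _).trans (kx 0 0), hct, hcx, hdt, hdx,
    fun y t => (hKt (y, t)).trans (le_max_left _ _), kx, fun y t => hb (y, t), ?_, ?_⟩
  · intro y z
    have := Convex.norm_image_sub_le_of_norm_hasDerivWithin_le (s := Set.univ)
      (f := fun z => φ z 0) (f' := fun y => φx y 0) (C := max Kt Kx) (x := z) (y := y)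
      (fun w _ => (hdx w 0).hasDerivWithinAt) (fun w _ => kx w 0) convex_univ trivial trivial
    exact this
  · intro ε hε
    have hu := hsx.uniformContinuous_of_continuous hcx
    obtain ⟨δ, hδ, hh⟩ := Metric.uniformContinuous_iff.1 hu ε hε
    refine ⟨δ, hδ, fun y z t s h3 h4 => ?_⟩
    have := hh (a := (y, t)) (b := (z, s)) (max_lt (by rwa [Real.dist_eq]) (by rwa [Real.dist_eq]))
    rw [Real.dist_eq] at this
    exact this.le

lemma cws_weak_lim (R T A B c Lv K : ℝ) (hR : 0 < R) (hT : 0 < T) (v : ℝ → ℝ) (hLv0 : 0 ≤ Lv)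
    (hc0 : 0 ≤ c) (hK : 0 ≤ K)
    (hLv : ∀ a ∈ Set.Icc (0 : ℝ) R, ∀ b ∈ Set.Icc (0 : ℝ) R, |v a - v b| ≤ Lv * |a - b|)
    (hc : ∀ a ∈ Set.Icc (0 : ℝ) R, |v a| ≤ c) (hvm : Continuous v) (f : ℕ → ℝ → ℝ → ℝ)
    (ρ φt φx : ℝ → ℝ → ℝ)
    (hm : ∀ n, Measurable (Function.uncurry (f n)))
    (hb : ∀ n, ∀ t ∈ Set.Ico 0 T, ∀ y, f n y t ∈ Set.Icc 0 R)
    (hz : ∀ n, ∀ t ∈ Set.Ico 0 T, ∀ y, y ∉ Set.Icc A B → f n y t = 0)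
    (hρm : Measurable (Function.uncurry ρ)) (hρb : ∀ y t, ρ y t ∈ Set.Icc 0 R)
    (hρz : ∀ y t, y ∉ Set.Icc A B → ρ y t = 0)
    (hct : Continuous (Function.uncurry φt)) (hcx : Continuous (Function.uncurry φx))
    (hKt : ∀ y t, |φt y t| ≤ K) (hKx : ∀ y t, |φx y t| ≤ K)
    (hlim : Tendsto (fun k => ∫ t in (0:ℝ)..T, ∫ y, |f k y t - ρ y t|) atTop (nhds 0)) :
    Tendsto (fun k => ∫ t in (0:ℝ)..T, ∫ y, (f k y t * φt y t + f k y t * v (f k y t) * φx y t))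
      atTop (nhds (∫ t in (0:ℝ)..T, ∫ y, (ρ y t * φt y t + ρ y t * v (ρ y t) * φx y t))) := by
  have hIo : ∀ t, t ∈ Set.Ioo 0 T → t ∈ Set.Ico 0 T := fun t ht => ⟨ht.1.le, ht.2⟩
  have gm : ∀ g : ℝ → ℝ → ℝ, Measurable (Function.uncurry g) →
      Measurable (Function.uncurry fun y t => g y t * φt y t + g y t * v (g y t) * φx y t) := by
    intro g hg
    exact (hg.mul hct.measurable).add ((hg.mul (hvm.measurable.comp hg)).mul hcx.measurable)
  have gb : ∀ g : ℝ → ℝ → ℝ, (∀ t ∈ Set.Ioo 0 T, ∀ y, g y t ∈ Set.Icc 0 R) →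
      ∀ t ∈ Set.Ioo 0 T, ∀ y, |g y t * φt y t + g y t * v (g y t) * φx y t| ≤ R * K + R * c * K := by
    intro g hg t ht y
    have h1 := hg t ht y
    have h2 := hc _ h1
    have h3 := hKt y t
    have h4 := hKx y t
    have h5 : |g y t| ≤ R := by rw [abs_of_nonneg h1.1]; exact h1.2
    refine (abs_add_le _ _).trans ?_
    rw [abs_mul, abs_mul, abs_mul]
    gcongr
  have gz : ∀ g : ℝ → ℝ → ℝ, (∀ t ∈ Set.Ioo 0 T, ∀ y, y ∉ Set.Icc A B → g y t = 0) →
      ∀ t ∈ Set.Ioo 0 T, ∀ y, y ∉ Set.Icc A B →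
      g y t * φt y t + g y t * v (g y t) * φx y t = 0 := by
    intro g hg t ht y hy
    rw [hg t ht y hy]; ring
  have fb' : ∀ n, ∀ t ∈ Set.Ioo 0 T, ∀ y, f n y t ∈ Set.Icc 0 R := fun n t ht => hb n t (hIo t ht)
  have fz' : ∀ n, ∀ t ∈ Set.Ioo 0 T, ∀ y, y ∉ Set.Icc A B → f n y t = 0 :=
    fun n t ht => hz n t (hIo t ht)
  have rb' : ∀ t ∈ Set.Ioo 0 T, ∀ y, ρ y t ∈ Set.Icc 0 R := fun t _ y => hρb y t
  have rz' : ∀ t ∈ Set.Ioo 0 T, ∀ y, y ∉ Set.Icc A B → ρ y t = 0 := fun t _ y => hρz y t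
  rw [tendsto_iff_norm_sub_tendsto_zero]
  have hlim' := hlim.const_mul (K + (c + R * Lv) * K)
  rw [mul_zero] at hlim'
  refine squeeze_zero (fun k => norm_nonneg _) (fun k => ?_) hlim'
  have hbd : ∀ t ∈ Set.Ioo 0 T, ∀ y, |(|f k y t - ρ y t|)| ≤ R := by
    intro t ht y
    rw [abs_abs, abs_le]
    have h1 := fb' k t ht y
    have h2 := hρb y t
    constructor <;> linarith [h1.1, h1.2, h2.1, h2.2]
  have hmm : Measurable (Function.uncurry fun y t => |f k y t - ρ y t|) :=
    ((hm k).sub hρm).abs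
  rw [cws_bridge A B T _ hT (fun y t => f k y t * φt y t + f k y t * v (f k y t) * φx y t)
      (gm _ (hm k)) (gb _ (fb' k)) (gz _ (fz' k)),
    cws_bridge A B T _ hT (fun y t => ρ y t * φt y t + ρ y t * v (ρ y t) * φx y t)
      (gm _ hρm) (gb _ rb') (gz _ rz'),
    cws_bridge A B T R hT (fun y t => |f k y t - ρ y t|) hmm hbd (by
      intro t ht y hy
      rw [fz' k t ht y hy, hρz y t hy]; simp),
    ← integral_sub (cws_int_mu A B T _ _ (gm _ (hm k)) (gb _ (fb' k)))
      (cws_int_mu A B T _ _ (gm _ hρm) (gb _ rb')), ← integral_const_mul]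
  refine norm_integral_le_of_norm_le ((cws_int_mu A B T R _ hmm hbd).const_mul _) ?_
  filter_upwards [cws_ae_mu A B T] with p hp
  rcases p with ⟨y, t⟩
  simp only [Function.uncurry, Real.norm_eq_abs]
  have h1 := fb' k t hp.2 y
  have h2 := hρb y t
  have h3 := hKt y t
  have h4 := hKx y t
  generalize f k y t = a at h1
  generalize ρ y t = b at h2
  have e : a * φt y t + a * v a * φx y t - (b * φt y t + b * v b * φx y t) =
    (a - b) * φt y t + ((a - b) * v a + b * (v a - v b)) * φx y t := by ring
  rw [e]
  have q1 := hLv a h1 b h2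
  have q2 := hc a h1
  have q3 : |b| ≤ R := by rw [abs_of_nonneg h2.1]; exact h2.2
  have q4 : |(a - b) * v a + b * (v a - v b)| ≤ |a - b| * c + R * (Lv * |a - b|) := by
    refine (abs_add_le _ _).trans ?_
    rw [abs_mul, abs_mul]
    gcongr
  calc |(a - b) * φt y t + ((a - b) * v a + b * (v a - v b)) * φx y t|
      ≤ |a - b| * K + (|a - b| * c + R * (Lv * |a - b|)) * K := by
        refine (abs_add_le _ _).trans ?_
        rw [abs_mul, abs_mul]
        gcongr
    _ = _ := by ring


theorem convergence_to_weak_solution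
    (R T L θ Lv : ℝ) (v : ℝ → ℝ) (ρb : ℝ → ℝ)
    (Nn Mn : ℕ → ℕ) (x : ℕ → ℕ → ℕ → ℝ)
    (hR : 0 < R) (hT : 0 < T) (hLpos : 0 < L)
    (hθ : θ ∈ Set.Icc (0 : ℝ) 1)
    (hv : ContDiffOn ℝ 1 v (Set.Icc 0 R))
    (hv' : ∀ ρ' ∈ Set.Icc (0 : ℝ) R, derivWithin v (Set.Icc 0 R) ρ' < 0)
    (hvleft : ∀ ρ' < (0 : ℝ), v ρ' = v 0)
    (hvright : ∀ ρ', R < ρ' → v ρ' = v R)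
    (hLv : ∀ a ∈ Set.Icc (0 : ℝ) R, ∀ b ∈ Set.Icc (0 : ℝ) R, |v a - v b| ≤ Lv * |a - b|)
    (hBV : BoundedVariationOn ρb Set.univ)
    (hsupp : HasCompactSupport ρb)
    (hbound : ∀ᵐ z ∂(volume : Measure ℝ), ρb z ∈ Set.Icc 0 R)
    (hLdef : (∫ z, ρb z) = L)
    (hNpos : ∀ n, 0 < Nn n) (hMpos : ∀ n, 0 < Mn n)
    (hNtop : Tendsto Nn atTop atTop) (hMtop : Tendsto Mn atTop atTop)
    (hCFL : ∀ n, θ * (Nn n) * T * Lv * R ^ 2 < L * (Mn n))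
    (hscheme : ∀ n, IsScheme (Nn n) (Mn n) (L / Nn n) (T / Mn n) θ v (x n))
    (hinit0 : ∀ n, x n 0 0 = sInf (tsupport ρb))
    (hinit : ∀ n, ∀ i < Nn n,
      IsLeast {z : ℝ | x n i 0 ≤ z ∧ L / Nn n ≤ ∫ s in (x n i 0)..z, ρb s} (x n (i + 1) 0))
    (hbnd : ∀ n, ∀ m ≤ Mn n, ∀ i < Nn n,
      0 < Rd (Nn n) (L / Nn n) (x n) i m ∧ Rd (Nn n) (L / Nn n) (x n) i m ≤ R) :
    ∃ φs : ℕ → ℕ, StrictMono φs ∧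
      ∃ ρ : ℝ → ℝ → ℝ,
        Measurable (Function.uncurry ρ) ∧
        (∃ A B : ℝ, ∀ t ∈ Set.Icc (0 : ℝ) T, ∀ y : ℝ, (y < A ∨ B < y) → ρ y t = 0) ∧
        (∀ t ∈ Set.Icc (0 : ℝ) T, ∀ᵐ y ∂(volume : Measure ℝ), ρ y t ∈ Set.Icc 0 R) ∧
        (∀ φ : ℝ → ℝ → ℝ,
          ContDiff ℝ 1 (Function.uncurry φ) →
          HasCompactSupport (Function.uncurry φ) →
          (∀ y : ℝ, ∀ t : ℝ, T ≤ t → φ y t = 0) →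
          (∫ t in (0 : ℝ)..T, ∫ y : ℝ,
              (ρ y t * deriv (fun s => φ y s) t +
                ρ y t * v (ρ y t) * deriv (fun z => φ z t) y)) +
            (∫ y : ℝ, ρb y * φ y 0) = 0) ∧
        Tendsto
          (fun k => ∫ t in (0 : ℝ)..T, ∫ y : ℝ,
            |discDens (Nn (φs k)) (Mn (φs k)) (L / Nn (φs k)) (T / Mn (φs k)) (x (φs k)) y t -
              ρ y t|)
          atTop (nhds 0) := by
  have hIntg : Integrable ρb := by
    by_contra h
    rw [integral_undef h] at hLdef
    exact hLpos.ne hLdef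
  have hanti := cws_v_anti R v hv hv'
  have hc := cws_v_bound R v hR hanti
  have hvc := cws_v_cont R v hR hv.continuousOn hvleft hvright
  set c := |v 0| + |v R| with hcdef
  have hc0 : 0 ≤ c := by positivity
  have hLv0 : 0 ≤ Lv := by
    have := hLv 0 ⟨le_rfl, hR.le⟩ R ⟨hR.le, le_rfl⟩
    rw [zero_sub, abs_neg, abs_of_pos hR] at this
    by_contra hneg
    push Not at hneg
    linarith [abs_nonneg (v 0 - v R), mul_neg_of_neg_of_pos hneg hR]
  set C := R + ((eVariationOn ρb Set.univ).toReal + R) with hCdef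
  have hC0 : 0 ≤ C := by positivity
  set A := sInf (tsupport ρb) - c * T with hA
  set B := sSup (tsupport ρb) + c * T with hB
  have hall := fun n => cws_cfg R T L θ Lv c v ρb (Nn n) (Mn n) (x n) hR hT hLpos hθ hanti hLv hc0 hc
    hBV hsupp hbound hLdef hIntg (hNpos n) (hMpos n) (hCFL n) (hscheme n) (hinit0 n) (hinit n) (hbnd n)
  have H := fun n => (hall n).1
  have hmove := fun n => (hall n).2
  have hMT : ∀ n, (Mn n : ℝ) * (T / Mn n) = T := by
    intro n
    have : (Mn n : ℝ) ≠ 0 := by exact_mod_cast (hMpos n).ne'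
    field_simp
  have hNL : ∀ n, (Nn n : ℝ) * (L / Nn n) = L := by
    intro n
    have : (Nn n : ℝ) ≠ 0 := by exact_mod_cast (hNpos n).ne'
    field_simp
  have hτ0 : Tendsto (fun n => T / (Mn n : ℝ)) atTop (nhds 0) :=
    tendsto_const_nhds.div_atTop (tendsto_natCast_atTop_atTop.comp hMtop)
  have hl0 : Tendsto (fun n => L / (Nn n : ℝ)) atTop (nhds 0) :=
    tendsto_const_nhds.div_atTop (tendsto_natCast_atTop_atTop.comp hNtop)
  have hAB : A ≤ B := by
    have h1 := (H 0).lo 0 (Nat.zero_le _)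
    have h2 := (H 0).hi 0 (Nat.zero_le _)
    have h3 := cws_mono_X (Nn 0) (fun i => x 0 i 0) ((H 0).mono 0 (Nat.zero_le _)) (Nn 0) le_rfl 0
      (Nat.zero_le _)
    exact h1.trans (h3.trans h2)
  obtain ⟨φs, hφs, hcau⟩ := cws_compact R Lv C A B θ c T L v Nn Mn (fun n => L / Nn n)
    (fun n => T / Mn n) x H hR hc0 hT hC0 hAB hmove hMT hNL hτ0
  have hprops := fun k => cws_disc_props R Lv C A B θ T v _ _ _ _ _ (H (φs k)) hR (hMT (φs k))
  have hfm := fun k => cws_disc_meas (Nn (φs k)) (Mn (φs k)) (L / Nn (φs k)) (T / Mn (φs k))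
    (x (φs k))
  obtain ⟨ρ, hρm, hρb, hρz, hlim⟩ := cws_limit R T A B hR hT
    (fun k => discDens (Nn (φs k)) (Mn (φs k)) (L / Nn (φs k)) (T / Mn (φs k)) (x (φs k)))
    hfm (fun k t ht y => (hprops k t ht y).1) (fun k t ht y => (hprops k t ht y).2) hcau
  refine ⟨φs, hφs, ρ, hρm, ⟨A, B, fun t _ y hy => hρz y t ?_⟩,
    fun t _ => Eventually.of_forall fun y => hρb y t, ?_, hlim⟩
  · rintro ⟨h1, h2⟩
    rcases hy with h | h <;> linarith
  intro φ hφ1 hφ2 hφT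
  obtain ⟨φt, φx, K, b, hK, hct, hcx, hdt, hdx, hKt, hKx, hb, hlip, hunif⟩ := cws_test φ hφ1 hφ2
  have e1 : ∀ y t, deriv (fun s => φ y s) t = φt y t := fun y t => (hdt y t).deriv
  have e2 : ∀ y t, deriv (fun z => φ z t) y = φx y t := fun y t => (hdx y t).deriv
  simp only [e1, e2]
  have hwl := cws_weak_lim R T A B c Lv K hR hT v hLv0 hc0 hK hLv hc hvc
    (fun k => discDens (Nn (φs k)) (Mn (φs k)) (L / Nn (φs k)) (T / Mn (φs k)) (x (φs k))) ρ φt φx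
    hfm (fun k t ht y => (hprops k t ht y).1) (fun k t ht y => (hprops k t ht y).2) hρm hρb hρz
    hct hcx hKt hKx hlim
  set J := ∫ y : ℝ, ρb y * φ y 0 with hJ
  set I := ∫ t in (0:ℝ)..T, ∫ y, (ρ y t * φt y t + ρ y t * v (ρ y t) * φx y t) with hI
  have hτs := hτ0.comp hφs.tendsto_atTop
  have hls := hl0.comp hφs.tendsto_atTop
  have key : ∀ ε > 0, |I + J| ≤ T * (L * c * ε) := by
    intro ε hε
    obtain ⟨δ, hδ, hδ'⟩ := hunif ε hε
    have ev1 : ∀ᶠ k in atTop, T / (Mn (φs k) : ℝ) < δ := hτs.eventually_lt_const hδ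
    have ev2 : ∀ᶠ k in atTop, c * (T / (Mn (φs k) : ℝ)) < δ := by
      have := hτs.const_mul c
      rw [mul_zero] at this
      exact this.eventually_lt_const hδ
    have hL : Tendsto (fun k => |(∫ t in (0:ℝ)..T, ∫ y,
        (discDens (Nn (φs k)) (Mn (φs k)) (L / Nn (φs k)) (T / Mn (φs k)) (x (φs k)) y t * φt y t +
        discDens (Nn (φs k)) (Mn (φs k)) (L / Nn (φs k)) (T / Mn (φs k)) (x (φs k)) y t *
        v (discDens (Nn (φs k)) (Mn (φs k)) (L / Nn (φs k)) (T / Mn (φs k)) (x (φs k)) y t) *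
        φx y t)) + J|) atTop (nhds |I + J|) := (hwl.add_const J).abs
    have hRt : Tendsto (fun k => T * (K * (Lv * (R^2 * (T / Mn (φs k)) * Lv * (2 * C)) +
        Lv * (L / Nn (φs k)) * (2 * C)) + L * c * ε) +
        2 * K * (sSup (tsupport ρb) - sInf (tsupport ρb)) * (L / Nn (φs k))) atTop
        (nhds (T * (K * (Lv * (R^2 * 0 * Lv * (2 * C)) + Lv * 0 * (2 * C)) + L * c * ε) +
          2 * K * (sSup (tsupport ρb) - sInf (tsupport ρb)) * 0)) := by
      refine Tendsto.add (Tendsto.const_mul _ (Tendsto.add_const _ (Tendsto.const_mul _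
        (Tendsto.add (Tendsto.const_mul _ ?_) ?_)))) (Tendsto.const_mul _ hls)
      · exact ((hτs.const_mul (R^2)).mul_const Lv).mul_const (2 * C)
      · exact (hls.const_mul Lv).mul_const (2 * C)
    have hfin := le_of_tendsto_of_tendsto hL hRt ?_
    · simpa using hfin
    · filter_upwards [ev1, ev2] with k h1 h2
      have w1 := cws_weak R Lv C A B θ c T L K ε v _ _ _ _ _ (H (φs k)) hR hθ.1 hθ.2 hLv0 hLv hc
        (hMT _) (hNL _) φ φt φx hφ1.continuous hct hcx hdt hdx hKx
        (fun y z t s q1 q2 => hδ' y z t s (lt_of_le_of_lt q1 h2) (lt_of_le_of_lt q2 h1))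
        (fun y => hφT y T le_rfl)
      have w2 := cws_init_conv L R K b (sSup (tsupport ρb) - sInf (tsupport ρb)) ρb (Nn (φs k))
        (fun i => x (φs k) i 0) hLpos (hNpos _) hIntg hsupp hbound hLdef (hinit0 _)
        ((H (φs k)).mono 0 (Nat.zero_le _)) (hinit _) (fun y => φ y 0)
        (hφ1.continuous.comp (by fun_prop : Continuous fun y : ℝ => (y, (0:ℝ))))
        (fun y => hb y 0) hK hlip le_rfl
      rw [← hJ] at w2
      have tri : ∀ a p q : ℝ, |a + q| ≤ |a + p| + |q - p| := by
        intro a p q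
        have : a + q = (a + p) + (q - p) := by ring
        rw [this]; exact abs_add_le _ _
      exact (tri _ _ _).trans (add_le_add w1 w2)
  have hz : |I + J| ≤ 0 := by
    refine le_of_forall_pos_le_add fun ε hε => ?_
    have hD : 0 ≤ T * (L * c) := by positivity
    have h1 := key (ε / (T * (L * c) + 1)) (by positivity)
    refine h1.trans ?_
    rw [zero_add]
    have : T * (L * c * (ε / (T * (L * c) + 1))) = (T * (L * c)) / (T * (L * c) + 1) * ε := by
      field_simp
    rw [this]
    have h2 : (T * (L * c)) / (T * (L * c) + 1) ≤ 1 := by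
      rw [div_le_one (by linarith)]; linarith
    nlinarith
  exact abs_eq_zero.1 (le_antisymm hz (abs_nonneg _))
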